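/- Let n ∈ ℤ, n ≥ 2, and let S ⊆ 𝕋 be a finite set. Then the intersection of {s ∈ ℝ : the closure of 𝒪^ℕ_{T_n}([s]) in 𝕋 is disjoint from S} with ⋂_m D̃(T_m) (over all natural numbers m ≥ 2 multiplicatively independent from n) and with WA(1), the set of well approximable real numbers, has Hausdorff dimension 1. -/

import Mathlib

open MeasureTheory Matrix Filter Set
open scoped ENNReal

noncomputable section

/-- The circle `𝕋 = ℝ/ℤ`. -/
abbrev Circ := UnitAddCircle

/-- `n` and `m` are multiplicatively independent: there are no integers `p, q ≥ 1`
with `n^p = m^q`. -/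
def MultIndep (n : ℤ) (m : ℕ) : Prop :=
  ¬ ∃ p q : ℕ, 1 ≤ p ∧ 1 ≤ q ∧ n ^ p = (m : ℤ) ^ q

/-- A real number `s` is badly approximable if `|s - p/q| ≥ c/q²` for some `c > 0` and
all rationals `p/q`. -/
def BadlyApproximable1 (s : ℝ) : Prop :=
  ∃ c > 0, ∀ (p : ℤ) (q : ℕ), 0 < q → c / (q : ℝ) ^ 2 ≤ |s - (p : ℝ) / (q : ℝ)|

/-- `μ` is the natural self-similar probability measure on the Cantor set of the `x ∈ [0, 1]`
whose base-`B` digits all lie in `D`. -/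
structure IsCantorMeasure (B : ℕ) (D : Finset ℕ) (μ : Measure ℝ) : Prop where
  isProb : IsProbabilityMeasure μ
  support : ∀ᵐ x ∂μ, x ∈ Icc (0 : ℝ) 1
  selfSimilar : ∀ A : Set ℝ, MeasurableSet A →
    μ A = ∑ d ∈ D, (D.card : ℝ≥0∞)⁻¹ * μ ((fun x : ℝ => ((d : ℝ) + x) / B) ⁻¹' A)

section Existence

variable {α : Type*} [MeasurableSpace α]

/-- Prepend a term to a sequence. -/
def seqCons (p : α × (ℕ → α)) : ℕ → α := fun i => Nat.casesOn i p.1 p.2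

lemma measurable_seqCons : Measurable (seqCons (α := α)) := by
  refine measurable_pi_lambda _ fun i => ?_
  cases i with
  | zero => exact measurable_fst
  | succ i => exact (measurable_pi_apply i).comp measurable_snd

lemma map_seqCons_prod_infinitePi (ν : Measure α) [IsProbabilityMeasure ν] :
    (ν.prod (Measure.infinitePi fun _ : ℕ => ν)).map seqCons
      = Measure.infinitePi fun _ : ℕ => ν := by
  classical
  refine Measure.eq_infinitePi _ fun s t ht => ?_
  obtain ⟨n, hn⟩ : ∃ n, s ⊆ Finset.range (n + 1) := by
    obtain ⟨n, hn⟩ := s.exists_nat_subset_range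
    exact ⟨n, hn.trans (Finset.range_mono n.le_succ)⟩
  set u : ℕ → Set α := fun i => if i ∈ s then t i else univ with hu
  have hum : ∀ i, MeasurableSet (u i) := fun i => by
    simp only [hu]; split_ifs
    exacts [ht i, MeasurableSet.univ]
  have hbox : (Set.pi (↑s) t : Set (ℕ → α)) = Set.pi (↑(Finset.range (n + 1))) u := by
    ext x
    simp only [Set.mem_pi, Finset.mem_coe, hu]
    constructor
    · intro h i _
      split_ifs with his
      exacts [h i his, mem_univ _]
    · intro h i his
      simpa [his] using h i (hn his)
  have hpre : seqCons ⁻¹' (Set.pi (↑(Finset.range (n + 1))) u)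
      = u 0 ×ˢ (Set.pi (↑(Finset.range n)) fun i => u (i + 1)) := by
    ext ⟨a, x⟩
    simp only [Set.mem_preimage, Set.mem_pi, Finset.mem_coe, Finset.mem_range, Set.mem_prod]
    constructor
    · intro h
      exact ⟨h 0 (Nat.succ_pos n), fun i hi => h (i + 1) (by omega)⟩
    · rintro ⟨h0, h1⟩ i hi
      cases i with
      | zero => exact h0
      | succ i => exact h1 i (by omega)
  have hprod : ∏ i ∈ s, ν (t i) = ∏ i ∈ Finset.range (n + 1), ν (u i) := by
    rw [← Finset.prod_subset hn]
    · exact Finset.prod_congr rfl fun i hi => by simp [hu, hi]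
    · intro i _ hi
      simp [hu, hi]
  rw [hprod, hbox, Measure.map_apply measurable_seqCons, hpre, Measure.prod_prod,
    Measure.infinitePi_pi _ (fun i _ => hum (i + 1)), Finset.prod_range_succ', mul_comm]
  exact MeasurableSet.pi (Finset.countable_toSet _) fun i _ => hum i

end Existence

lemma summable_digits {B : ℕ} (hB : 2 ≤ B) {x : ℕ → ℝ} (hx : ∀ i, 0 ≤ x i ∧ x i ≤ B - 1) :
    Summable fun i => x i / (B : ℝ) ^ (i + 1) := by
  have hB' : (2 : ℝ) ≤ B := by exact_mod_cast hB
  have hg : Summable fun i : ℕ => ((B : ℝ)⁻¹) ^ i :=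
    summable_geometric_of_lt_one (by positivity) (inv_lt_one_of_one_lt₀ (by linarith))
  refine Summable.of_nonneg_of_le (fun i => div_nonneg (hx i).1 (by positivity)) (fun i => ?_) hg
  rw [inv_pow, div_le_iff₀ (by positivity), pow_succ, inv_mul_cancel_left₀ (by positivity)]
  linarith [(hx i).2]

theorem exists_isCantorMeasure {B : ℕ} (hB : 2 ≤ B) {D : Finset ℕ} (hD : D.Nonempty)
    (hDB : ∀ d ∈ D, d < B) : ∃ μ : Measure ℝ, IsCantorMeasure B D μ := by
  have hB' : (2 : ℝ) ≤ B := by exact_mod_cast hB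
  have hcard : (D.card : ℝ≥0∞) ≠ 0 := by simpa using hD.ne_empty
  let ν : Measure D := (D.card : ℝ≥0∞)⁻¹ • Measure.count
  have hν : IsProbabilityMeasure ν := ⟨by
    simp only [ν, Measure.smul_apply, smul_eq_mul, Measure.count_univ]
    simp only [ENat.card_eq_coe_fintype_card, Fintype.card_coe]
    exact ENNReal.inv_mul_cancel hcard (ENNReal.natCast_ne_top _)⟩
  let P : Measure (ℕ → D) := Measure.infinitePi fun _ => ν
  let X : (ℕ → D) → ℝ := fun ω => ∑' i, ((ω i : ℕ) : ℝ) / (B : ℝ) ^ (i + 1)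
  have hdig : ∀ (ω : ℕ → D) i, 0 ≤ ((ω i : ℕ) : ℝ) ∧ ((ω i : ℕ) : ℝ) ≤ B - 1 := fun ω i => by
    refine ⟨by positivity, ?_⟩
    have : ((ω i : ℕ) : ℝ) + 1 ≤ B := by exact_mod_cast hDB _ (ω i).2
    linarith
  have hsum := fun ω : ℕ → D => summable_digits hB (hdig ω)
  have hX : Measurable X := by
    refine measurable_of_tendsto_metrizable
      (f := fun n ω => ∑ i ∈ Finset.range n, ((ω i : ℕ) : ℝ) / (B : ℝ) ^ (i + 1)) (fun n => ?_) ?_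
    · refine Finset.measurable_sum _ fun i _ => Measurable.div_const ?_ _
      exact (measurable_of_countable fun d : D => ((d : ℕ) : ℝ)).comp (measurable_pi_apply i)
    · exact tendsto_pi_nhds.2 fun ω => (hsum ω).hasSum.tendsto_sum_nat
  have hXcons : ∀ d ω, X (seqCons (d, ω)) = (((d : ℕ) : ℝ) + X ω) / B := fun d ω => by
    have h := (hsum (seqCons (d, ω))).tsum_eq_zero_add
    simp only [X]
    rw [h, add_div, ← tsum_div_const]
    simp only [seqCons, zero_add, pow_one]
    congr 1
    refine tsum_congr fun i => ?_
    rw [pow_succ _ (i + 1), div_div]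
  have hgeo : HasSum (fun i : ℕ => ((B : ℝ) - 1) / (B : ℝ) ^ (i + 1)) 1 := by
    have h := (hasSum_geometric_of_lt_one (r := (B : ℝ)⁻¹) (by positivity)
      (inv_lt_one_of_one_lt₀ (by linarith))).mul_left (((B : ℝ) - 1) / B)
    have h1 : (B : ℝ) - 1 ≠ 0 := by linarith
    rw [show ((B : ℝ) - 1) / B * (1 - (B : ℝ)⁻¹)⁻¹ = 1 by field_simp] at h
    refine h.congr_fun fun i => ?_
    rw [pow_succ, inv_pow]
    field_simp
  refine ⟨P.map X, Measure.isProbabilityMeasure_map hX.aemeasurable, ?_, fun A hA => ?_⟩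
  · refine (ae_map_iff hX.aemeasurable measurableSet_Icc).2 ?_
    refine ae_of_all _ fun ω => ⟨tsum_nonneg fun i => div_nonneg (hdig ω i).1 (by positivity), ?_⟩
    rw [← hgeo.tsum_eq]
    exact (hsum ω).tsum_le_tsum (fun i => by gcongr; exact (hdig ω i).2) hgeo.summable
  · have hXA := hX hA
    rw [Measure.map_apply hX hA]
    have key : P (X ⁻¹' A) = (ν.prod P) (seqCons ⁻¹' (X ⁻¹' A)) := by
      conv_lhs => rw [show P = (ν.prod P).map seqCons from (map_seqCons_prod_infinitePi ν).symm]
      rw [Measure.map_apply measurable_seqCons hXA]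
    rw [key, Measure.prod_apply (measurable_seqCons hXA), lintegral_smul_measure,
      lintegral_count, tsum_fintype, smul_eq_mul, Finset.mul_sum, ← Finset.sum_coe_sort D]
    refine Finset.sum_congr rfl fun d _ => ?_
    rw [Measure.map_apply hX ((by fun_prop : Measurable fun x : ℝ => ((d : ℕ) + x) / (B:ℝ)) hA)]
    congr 2
    ext ω
    simp [hXcons]

/-- The integers with `N` base-`B` digits all lying in `D`. -/
def digitWords (B : ℕ) (D : Finset ℕ) : ℕ → Finset ℕ
  | 0 => {0}
  | N + 1 => (digitWords B D N ×ˢ D).image fun p => B * p.1 + p.2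

/-- The similarity of the line sending `[0, 1]` to the `w`-th interval of length `B ^ (-N)`. -/
def cylMap (B N w : ℕ) (x : ℝ) : ℝ := ((w : ℝ) + x) / (B : ℝ) ^ N

lemma measurable_cylMap (B N w : ℕ) : Measurable (cylMap B N w) := by
  unfold cylMap; fun_prop

lemma continuous_cylMap (B N w : ℕ) : Continuous (cylMap B N w) := by
  unfold cylMap; fun_prop

section Words

variable {B : ℕ} {D : Finset ℕ}

lemma injOn_append_digit (hDB : ∀ d ∈ D, d < B) (N : ℕ) :
    Set.InjOn (fun p : ℕ × ℕ => B * p.1 + p.2) ↑(digitWords B D N ×ˢ D) := by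
  rintro ⟨w, d⟩ h ⟨w', d'⟩ h' heq
  simp only [Finset.coe_product, Set.mem_prod, Finset.mem_coe] at h h' heq
  have hd := hDB d h.2
  have hd' := hDB d' h'.2
  have h1 : (B * w + d) % B = (B * w' + d') % B := by rw [heq]
  rw [Nat.mul_add_mod, Nat.mul_add_mod, Nat.mod_eq_of_lt hd, Nat.mod_eq_of_lt hd'] at h1
  subst h1
  have : w = w' := Nat.eq_of_mul_eq_mul_left (by omega) (Nat.add_right_cancel heq)
  rw [this]

lemma cylMap_append_digit (hB : 2 ≤ B) (N w d : ℕ) (x : ℝ) :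
    cylMap B (N + 1) (B * w + d) x = cylMap B N w (((d : ℝ) + x) / B) := by
  have : (B : ℝ) ≠ 0 := by positivity
  unfold cylMap
  push_cast
  field_simp
  ring

end Words

namespace IsCantorMeasure

variable {B : ℕ} {D : Finset ℕ} {μ : Measure ℝ}

lemma nonempty (hμ : IsCantorMeasure B D μ) : D.Nonempty := by
  have := hμ.isProb
  rw [Finset.nonempty_iff_ne_empty]
  rintro rfl
  have := hμ.selfSimilar univ MeasurableSet.univ
  simp at this

lemma measure_eq_sum (hμ : IsCantorMeasure B D μ) (hB : 2 ≤ B) (hDB : ∀ d ∈ D, d < B) (N : ℕ)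
    {A : Set ℝ} (hA : MeasurableSet A) :
    μ A = ∑ w ∈ digitWords B D N, ((D.card : ℝ≥0∞)⁻¹) ^ N * μ (cylMap B N w ⁻¹' A) := by
  induction N with
  | zero =>
    have : cylMap B 0 0 = id := by ext x; simp [cylMap]
    simp [digitWords, this]
  | succ N ih =>
    rw [digitWords, Finset.sum_image (injOn_append_digit hDB N), Finset.sum_product, ih]
    refine Finset.sum_congr rfl fun w _ => ?_
    rw [hμ.selfSimilar _ (measurable_cylMap B N w hA), Finset.mul_sum]
    refine Finset.sum_congr rfl fun d _ => ?_
    rw [← mul_assoc, pow_succ]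
    congr 2
    ext x
    simp [cylMap_append_digit hB]

lemma measure_eq_zero_of_disjoint (hμ : IsCantorMeasure B D μ) {A : Set ℝ}
    (h : ∀ x ∈ Icc (0 : ℝ) 1, x ∉ A) : μ A = 0 := by
  refine measure_mono_null (fun x hx => ?_) hμ.support
  exact fun hx' => h x hx' hx

lemma measure_le_card_mul (hμ : IsCantorMeasure B D μ) (hB : 2 ≤ B) (hDB : ∀ d ∈ D, d < B) (N : ℕ)
    {A : Set ℝ} (hA : MeasurableSet A) (W : Finset ℕ)
    (hW : ∀ w ∈ digitWords B D N, ∀ x ∈ Icc (0 : ℝ) 1, cylMap B N w x ∈ A → w ∈ W) :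
    μ A ≤ ((D.card : ℝ≥0∞)⁻¹) ^ N * (W.card : ℝ≥0∞) := by
  have := hμ.isProb
  rw [hμ.measure_eq_sum hB hDB N hA]
  calc ∑ w ∈ digitWords B D N, ((D.card : ℝ≥0∞)⁻¹) ^ N * μ (cylMap B N w ⁻¹' A)
      ≤ ∑ w ∈ digitWords B D N, if w ∈ W then ((D.card : ℝ≥0∞)⁻¹) ^ N else 0 := by
        refine Finset.sum_le_sum fun w hw => ?_
        split_ifs with h
        · exact mul_le_of_le_one_right' prob_le_one
        · rw [hμ.measure_eq_zero_of_disjoint (A := cylMap B N w ⁻¹' A)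
            fun x hx hxA => h (hW w hw x hx hxA), mul_zero]
    _ = ∑ w ∈ digitWords B D N with w ∈ W, ((D.card : ℝ≥0∞)⁻¹) ^ N := by rw [Finset.sum_filter]
    _ ≤ ∑ w ∈ W, ((D.card : ℝ≥0∞)⁻¹) ^ N :=
        Finset.sum_le_sum_of_subset fun w hw => (Finset.mem_filter.1 hw).2
    _ = _ := by rw [Finset.sum_const, nsmul_eq_mul, mul_comm]

lemma measure_Icc_le (hμ : IsCantorMeasure B D μ) (hB : 2 ≤ B) (hDB : ∀ d ∈ D, d < B) (N : ℕ)
    (a : ℝ) : μ (Icc a (a + ((B : ℝ) ^ N)⁻¹)) ≤ ((D.card : ℝ≥0∞)⁻¹) ^ N * 4 := by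
  have hBN : (0 : ℝ) < (B : ℝ) ^ N := by positivity
  refine (hμ.measure_le_card_mul hB hDB N measurableSet_Icc
    (Finset.Icc (⌊a * (B : ℝ) ^ N - 1⌋₊) (⌊a * (B : ℝ) ^ N - 1⌋₊ + 3)) ?_).trans ?_
  · intro w _ x hx hw
    rw [cylMap, mem_Icc, le_div_iff₀ hBN, div_le_iff₀ hBN, add_mul, inv_mul_cancel₀ hBN.ne'] at hw
    rw [Finset.mem_Icc]
    constructor
    · rw [← Nat.floor_natCast (R := ℝ) w]
      exact Nat.floor_le_floor (by linarith [hx.2])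
    · have h1 := Nat.lt_floor_add_one (a * (B : ℝ) ^ N - 1)
      have h2 : (w : ℝ) < (⌊a * (B : ℝ) ^ N - 1⌋₊ : ℝ) + 3 := by linarith [hx.1]
      exact_mod_cast h2.le
  · rw [Nat.card_Icc]
    gcongr
    exact_mod_cast (by omega)

lemma ae_mem_digitWords (hμ : IsCantorMeasure B D μ) (hB : 2 ≤ B) (hDB : ∀ d ∈ D, d < B) :
    ∀ᵐ x ∂μ, ∀ N, ∃ w ∈ digitWords B D N, ∃ y ∈ Icc (0 : ℝ) 1, x = cylMap B N w y := by
  rw [ae_all_iff]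
  intro N
  have hcl : IsClosed (⋃ w ∈ digitWords B D N, cylMap B N w '' Icc (0 : ℝ) 1) :=
    isClosed_biUnion_finset fun w _ =>
      (isCompact_Icc.image (continuous_cylMap B N w)).isClosed
  have h0 : μ (⋃ w ∈ digitWords B D N, cylMap B N w '' Icc (0 : ℝ) 1)ᶜ = 0 := by
    have := hμ.measure_le_card_mul hB hDB N hcl.measurableSet.compl ∅ ?_
    · simpa using this
    · intro w hw x hx h
      exact absurd (mem_biUnion hw (mem_image_of_mem _ hx)) h
  refine measure_mono_null (fun x hx => ?_) h0
  contrapose! hx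
  simp only [mem_compl_iff, mem_iUnion, mem_image, not_not] at hx ⊢
  obtain ⟨w, hw, y, hy, rfl⟩ := hx
  exact ⟨w, hw, y, hy, rfl⟩

/-- A measurable set that occupies a fixed proportion of every cylinder has full measure. -/
theorem ae_mem_of_forall_le (hμ : IsCantorMeasure B D μ) (hB : 2 ≤ B) (hDB : ∀ d ∈ D, d < B)
    {A : Set ℝ} (hA : MeasurableSet A) {c : ℝ≥0∞} (hc : c ≠ 0)
    (h : ∀ N, ∀ w ∈ digitWords B D N, c ≤ μ (cylMap B N w ⁻¹' A)) : ∀ᵐ x ∂μ, x ∈ A := by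
  have := hμ.isProb
  have hB' : (2 : ℝ) ≤ B := by exact_mod_cast hB
  have hopen : ∀ U : Set ℝ, IsOpen U → c * μ U ≤ μ (A ∩ U) := by
    intro U hU
    let V : ℕ → Set ℝ := fun N => (Metric.cthickening ((B : ℝ) ^ N)⁻¹ Uᶜ)ᶜ
    have hVU : ⋃ N, V N = U := by
      ext x
      simp only [V, mem_iUnion, mem_compl_iff]
      constructor
      · rintro ⟨N, hN⟩
        by_contra hx
        exact hN (Metric.self_subset_cthickening _ hx)
      · intro hx
        obtain ⟨ε, hε, hball⟩ := Metric.isOpen_iff.1 hU x hx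
        obtain ⟨N, hN⟩ := exists_pow_lt_of_lt_one hε
          (inv_lt_one_of_one_lt₀ (by linarith : (1 : ℝ) < B))
        rw [inv_pow] at hN
        refine ⟨N, fun hx' => ?_⟩
        obtain ⟨y, hy, hxy⟩ := Metric.mem_thickening_iff.1
          (Metric.cthickening_subset_thickening' hε hN _ hx')
        exact hy (hball (by rwa [Metric.mem_ball, dist_comm]))
    have hmono : Monotone V := fun N M hNM => by
      refine compl_subset_compl.2 (Metric.cthickening_mono ?_ _)
      gcongr
      linarith
    rw [← hVU, hmono.measure_iUnion, ENNReal.mul_iSup, hVU]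
    refine iSup_le fun N => ?_
    classical
    let G := (digitWords B D N).filter fun w => cylMap B N w '' Icc (0 : ℝ) 1 ⊆ U
    have h1 : μ (V N) ≤ ((D.card : ℝ≥0∞)⁻¹) ^ N * (G.card : ℝ≥0∞) := by
      refine hμ.measure_le_card_mul hB hDB N Metric.isClosed_cthickening.measurableSet.compl G ?_
      intro w hw x hx hxV
      refine Finset.mem_filter.2 ⟨hw, ?_⟩
      rintro _ ⟨y, hy, rfl⟩
      by_contra hyU
      refine hxV (Metric.mem_cthickening_of_dist_le _ _ _ _ hyU ?_)
      rw [Real.dist_eq, cylMap, cylMap, ← sub_div, abs_div, abs_of_pos (by positivity :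
        (0 : ℝ) < (B : ℝ) ^ N), ← one_div]
      gcongr
      rw [abs_le]
      constructor <;> linarith [hx.1, hx.2, hy.1, hy.2]
    calc c * μ (V N) ≤ ∑ w ∈ G, ((D.card : ℝ≥0∞)⁻¹) ^ N * c := by
          rw [Finset.sum_const, nsmul_eq_mul, mul_comm c, ← mul_assoc]
          gcongr
          rw [mul_comm]
          exact h1
      _ ≤ ∑ w ∈ G, ((D.card : ℝ≥0∞)⁻¹) ^ N * μ (cylMap B N w ⁻¹' (A ∩ U)) := by
          refine Finset.sum_le_sum fun w hw => ?_
          gcongr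
          obtain ⟨hw, hwU⟩ := Finset.mem_filter.1 hw
          refine (h N w hw).trans (measure_mono_ae ?_)
          filter_upwards [hμ.support] with x hx hxA
          exact ⟨hxA, hwU (mem_image_of_mem _ hx)⟩
      _ ≤ _ := by
          rw [hμ.measure_eq_sum hB hDB N (hA.inter hU.measurableSet)]
          exact Finset.sum_le_sum_of_subset (Finset.filter_subset _ _)
  have hle : ∀ ε : ℝ≥0∞, ε ≠ 0 → c * μ Aᶜ ≤ ε := by
    intro ε hε
    obtain ⟨U, hAU, hU, hlt⟩ := Aᶜ.exists_isOpen_lt_add (μ := μ) (measure_ne_top _ _) hε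
    calc c * μ Aᶜ ≤ c * μ U := by gcongr
      _ ≤ μ (A ∩ U) := hopen U hU
      _ = μ (U \ Aᶜ) := by rw [sdiff_compl, inter_comm]
      _ = μ U - μ Aᶜ := measure_sdiff hAU hA.compl.nullMeasurableSet (measure_ne_top _ _)
      _ ≤ ε := tsub_le_iff_left.2 hlt.le
  have h0 : c * μ Aᶜ = 0 := by
    by_contra hne
    obtain ⟨ε, hε, hlt⟩ := exists_between (pos_iff_ne_zero.2 hne)
    exact absurd (hle ε hε.ne') (not_le.2 hlt)
  exact (mul_eq_zero.1 h0).resolve_left hc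

/-- Mass distribution principle for the Cantor measure. -/
theorem le_dimH (hμ : IsCantorMeasure B D μ) (hB : 2 ≤ B) (hDB : ∀ d ∈ D, d < B)
    (hD : 2 ≤ D.card) {E : Set ℝ} (hE : ∀ᵐ x ∂μ, x ∈ E) :
    ENNReal.ofReal (Real.log D.card / Real.log B) ≤ dimH E := by
  have := hμ.isProb
  have hB' : (2 : ℝ) ≤ B := by exact_mod_cast hB
  have hD' : (2 : ℝ) ≤ D.card := by exact_mod_cast hD
  set δ := Real.log D.card / Real.log B with hδ
  have hlogB : 0 < Real.log B := Real.log_pos (by linarith)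
  have hδ0 : 0 < δ := div_pos (Real.log_pos (by linarith)) hlogB
  have hBδ : (B : ℝ) ^ δ = D.card := by
    rw [Real.rpow_def_of_pos (by linarith), hδ, mul_div_cancel₀ _ hlogB.ne',
      Real.exp_log (by linarith)]
  have hinv : ((D.card : ℝ≥0∞)⁻¹) = ENNReal.ofReal ((D.card : ℝ)⁻¹) := by
    rw [ENNReal.ofReal_inv_of_pos (by linarith), ENNReal.ofReal_natCast]
  have hcover : ∀ (s : Set ℝ) (N : ℕ), s.Nonempty → Bornology.IsBounded s →
      Metric.diam s ≤ ((B : ℝ) ^ N)⁻¹ → μ s ≤ ((D.card : ℝ≥0∞)⁻¹) ^ N * 4 := by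
    intro s N hs hbd hdiam
    refine (measure_mono fun x hx => ?_).trans (hμ.measure_Icc_le hB hDB N (sInf s))
    have h1 := csInf_le hbd.bddBelow hx
    have h2 := le_csSup hbd.bddAbove hx
    rw [Real.diam_eq hbd] at hdiam
    exact ⟨h1, by linarith⟩
  let ν : Measure ℝ := (4 * (D.card : ℝ≥0∞))⁻¹ • μ
  have hc0 : (4 * (D.card : ℝ≥0∞)) ≠ 0 := by
    refine mul_ne_zero (by norm_num) ?_
    exact_mod_cast (by omega : D.card ≠ 0)
  have hctop : (4 * (D.card : ℝ≥0∞)) ≠ ∞ := ENNReal.mul_ne_top (by norm_num) (by simp)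
  have hνle : ν ≤ μH[δ] := by
    refine Measure.le_hausdorffMeasure δ ν 1 one_pos fun s hs => ?_
    rcases s.eq_empty_or_nonempty with rfl | hne
    · simp
    have hbd : Bornology.IsBounded s :=
      Metric.isBounded_iff_ediam_ne_top.2 (ne_top_of_le_ne_top ENNReal.one_ne_top hs)
    have hdiam1 : Metric.diam s ≤ 1 := by
      have := ENNReal.toReal_mono ENNReal.one_ne_top hs
      simpa [Metric.diam] using this
    have hofReal : Metric.ediam s = ENNReal.ofReal (Metric.diam s) :=
      (ENNReal.ofReal_toReal (ne_top_of_le_ne_top ENNReal.one_ne_top hs)).symm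
    simp only [ν, Measure.smul_apply, smul_eq_mul]
    rcases (Metric.diam_nonneg (s := s)).eq_or_lt with h0 | hpos
    · have hzero : μ s = 0 := by
        have hlim : Tendsto (fun N : ℕ => ((D.card : ℝ≥0∞)⁻¹) ^ N * 4) atTop (nhds (0 * 4)) := by
          refine ENNReal.Tendsto.mul_const ?_ (Or.inr (by norm_num))
          refine ENNReal.tendsto_pow_atTop_nhds_zero_of_lt_one (ENNReal.inv_lt_one.2 ?_)
          exact_mod_cast (by omega : 1 < D.card)
        rw [zero_mul] at hlim
        exact le_antisymm (ge_of_tendsto' hlim fun N => hcover s N hne hbd (by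
          rw [← h0]; positivity)) bot_le
      simp [hzero]
    · obtain ⟨N, hN1, hN2⟩ := exists_nat_pow_near_of_lt_one hpos hdiam1
        (inv_pos.2 (by linarith : (0 : ℝ) < B)) (inv_lt_one_of_one_lt₀ (by linarith))
      have hμs := hcover s N hne hbd (by rwa [← inv_pow])
      have hlow : ((D.card : ℝ≥0∞)⁻¹) ^ (N + 1) ≤ Metric.ediam s ^ δ := by
        rw [hofReal, ENNReal.ofReal_rpow_of_pos hpos, hinv, ← ENNReal.ofReal_pow (by positivity)]
        refine ENNReal.ofReal_le_ofReal ?_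
        calc ((D.card : ℝ)⁻¹) ^ (N + 1) = (((B : ℝ)⁻¹) ^ (N + 1)) ^ δ := by
              rw [← Real.rpow_natCast ((B : ℝ)⁻¹), ← Real.rpow_mul (by positivity), mul_comm,
                Real.rpow_mul (by positivity), Real.rpow_natCast, Real.inv_rpow (by positivity),
                hBδ]
          _ ≤ Metric.diam s ^ δ := Real.rpow_le_rpow (by positivity) hN1.le hδ0.le
      refine le_trans ?_ hlow
      rw [ENNReal.inv_mul_le_iff hc0 hctop]
      refine hμs.trans (le_of_eq ?_)
      rw [pow_succ', mul_assoc, ← mul_assoc (D.card : ℝ≥0∞), ENNReal.mul_inv_cancel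
        (by exact_mod_cast (by omega : D.card ≠ 0)) (by simp), one_mul, mul_comm]
  have hνE : ν E ≠ 0 := by
    have : μ E = 1 := by
      rw [← measure_univ (μ := μ)]
      exact measure_congr (eventuallyEq_univ.2 hE)
    simp only [ν, Measure.smul_apply, smul_eq_mul, this, mul_one]
    exact ENNReal.inv_ne_zero.2 hctop
  have hH : μH[((⟨δ, hδ0.le⟩ : NNReal) : ℝ)] E ≠ 0 := fun h =>
    hνE (le_antisymm ((hνle E).trans h.le) bot_le)
  have := le_dimH_of_hausdorffMeasure_ne_zero hH
  rwa [ENNReal.ofReal_eq_coe_nnreal hδ0.le]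

end IsCantorMeasure

/-- The additive character `t ↦ exp (2 * π * i * t)` of the line. -/
def addExp (t : ℝ) : ℂ := Complex.exp ((2 * Real.pi * t : ℝ) * Complex.I)

@[simp] lemma norm_addExp (t : ℝ) : ‖addExp t‖ = 1 := Complex.norm_exp_ofReal_mul_I _

lemma addExp_add (s t : ℝ) : addExp (s + t) = addExp s * addExp t := by
  rw [addExp, addExp, addExp, ← Complex.exp_add]
  congr 1
  push_cast
  ring


lemma addExp_int (k : ℤ) : addExp k = 1 := by
  rw [addExp, Complex.exp_eq_one_iff]
  exact ⟨k, by push_cast; ring⟩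

lemma continuous_addExp : Continuous addExp := by unfold addExp; fun_prop

lemma re_addExp (t : ℝ) : (addExp t).re = Real.cos (2 * Real.pi * t) :=
  Complex.exp_ofReal_mul_I_re _

lemma norm_addExp_sub_addExp_le (s t : ℝ) :
    ‖addExp s - addExp t‖ ≤ 2 * Real.pi * |s - t| := by
  have h : addExp s - addExp t = addExp t * (addExp (s - t) - 1) := by
    rw [mul_sub, ← addExp_add]; simp
  rw [h, norm_mul, norm_addExp, one_mul, addExp, mul_comm _ Complex.I]
  refine (Real.norm_exp_I_mul_ofReal_sub_one_le).trans (le_of_eq ?_)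
  rw [Real.norm_eq_abs, abs_mul, abs_of_pos Real.two_pi_pos]

/-- The Fourier transform of a measure on the line. -/
def fourierOf (μ : Measure ℝ) (t : ℝ) : ℂ := ∫ x, addExp (t * x) ∂μ

/-- The normalized exponential sum over the digit set `D`. -/
def digitSum (D : Finset ℕ) (t : ℝ) : ℂ := (D.card : ℂ)⁻¹ * ∑ d ∈ D, addExp (t * d)

lemma norm_digitSum_le_one (D : Finset ℕ) (t : ℝ) : ‖digitSum D t‖ ≤ 1 := by
  rw [digitSum, norm_mul, norm_inv, Complex.norm_natCast]
  refine inv_mul_le_one_of_le₀ ?_ (by positivity)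
  exact (norm_sum_le _ _).trans (by simp)

lemma digitSum_add_int (D : Finset ℕ) (t : ℝ) (k : ℤ) : digitSum D (t + k) = digitSum D t := by
  unfold digitSum
  congr 1
  refine Finset.sum_congr rfl fun d _ => ?_
  rw [add_mul, addExp_add, show (k : ℝ) * d = ((k * d : ℤ) : ℝ) by push_cast; ring, addExp_int,
    mul_one]

lemma integrable_addExp (μ : Measure ℝ) [IsProbabilityMeasure μ] (t : ℝ) :
    Integrable (fun x => addExp (t * x)) μ :=
  Integrable.of_bound (continuous_addExp.comp (continuous_const_mul t)).aestronglyMeasurable 1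
    (ae_of_all _ fun x => by simp)

lemma norm_fourierOf_le_one (μ : Measure ℝ) [IsProbabilityMeasure μ] (t : ℝ) :
    ‖fourierOf μ t‖ ≤ 1 := by
  have := norm_integral_le_of_norm_le_const (μ := μ) (f := fun x => addExp (t * x)) (C := 1)
    (ae_of_all _ fun x => by simp)
  simpa [fourierOf] using this

namespace IsCantorMeasure

variable {B : ℕ} {D : Finset ℕ} {μ : Measure ℝ}

lemma eq_sum_map (hμ : IsCantorMeasure B D μ) :
    μ = ∑ d ∈ D, (D.card : ℝ≥0∞)⁻¹ • μ.map (fun x : ℝ => ((d : ℝ) + x) / B) := by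
  ext A hA
  rw [hμ.selfSimilar A hA, Measure.finsetSum_apply]
  refine Finset.sum_congr rfl fun d _ => ?_
  rw [Measure.smul_apply, Measure.map_apply (by fun_prop) hA, smul_eq_mul]

lemma fourierOf_eq (hμ : IsCantorMeasure B D μ) (t : ℝ) :
    fourierOf μ t = digitSum D (t / B) * fourierOf μ (t / B) := by
  have := hμ.isProb
  have hmap : ∀ d : ℕ, IsProbabilityMeasure (μ.map (fun x : ℝ => ((d : ℝ) + x) / B)) :=
    fun d => Measure.isProbabilityMeasure_map (by fun_prop)
  have hinv : (D.card : ℝ≥0∞)⁻¹ ≠ ∞ :=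
    ENNReal.inv_ne_top.2 (by exact_mod_cast hμ.nonempty.card_pos.ne')
  conv_lhs => rw [fourierOf, hμ.eq_sum_map]
  rw [integral_finsetSum_measure fun d _ => (integrable_addExp _ t).smul_measure hinv,
    digitSum, mul_assoc, Finset.sum_mul, Finset.mul_sum]
  refine Finset.sum_congr rfl fun d _ => ?_
  rw [integral_smul_measure, integral_map (by fun_prop)
    (integrable_addExp _ t).aestronglyMeasurable, fourierOf,
    ← integral_const_mul, ENNReal.toReal_inv, ENNReal.toReal_natCast, Complex.real_smul]
  push_cast
  congr 2
  ext x
  rw [← addExp_add]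
  congr 1
  ring

lemma norm_fourierOf_le_div (hμ : IsCantorMeasure B D μ) (t : ℝ) :
    ‖fourierOf μ t‖ ≤ ‖fourierOf μ (t / B)‖ := by
  rw [hμ.fourierOf_eq t, norm_mul]
  exact mul_le_of_le_one_left (norm_nonneg _) (norm_digitSum_le_one _ _)

lemma norm_fourierOf_le_div_pow (hμ : IsCantorMeasure B D μ) (t : ℝ) (N : ℕ) :
    ‖fourierOf μ t‖ ≤ ‖fourierOf μ (t / (B : ℝ) ^ N)‖ := by
  induction N with
  | zero => simp
  | succ N ih =>
    rw [pow_succ, ← div_div]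
    exact ih.trans (hμ.norm_fourierOf_le_div _)

lemma norm_fourierOf_le_prod (hμ : IsCantorMeasure B D μ) (t : ℝ) (M : ℕ) :
    ‖fourierOf μ t‖ ≤ ∏ i ∈ Finset.range M, ‖digitSum D (t / (B : ℝ) ^ (i + 1))‖ := by
  have := hμ.isProb
  have h : ‖fourierOf μ t‖ = (∏ i ∈ Finset.range M, ‖digitSum D (t / (B : ℝ) ^ (i + 1))‖)
      * ‖fourierOf μ (t / (B : ℝ) ^ M)‖ := by
    induction M with
    | zero => simp
    | succ M ih =>
      rw [ih, Finset.prod_range_succ, hμ.fourierOf_eq (t / (B : ℝ) ^ M), norm_mul, div_div,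
        ← pow_succ, mul_assoc]
  rw [h]
  exact mul_le_of_le_one_right (Finset.prod_nonneg fun _ _ => norm_nonneg _)
    (norm_fourierOf_le_one μ _)

lemma norm_fourierOf_sub_le (hμ : IsCantorMeasure B D μ) (s t : ℝ) :
    ‖fourierOf μ s - fourierOf μ t‖ ≤ 2 * Real.pi * |s - t| := by
  have := hμ.isProb
  rw [fourierOf, fourierOf, ← integral_sub (integrable_addExp μ s) (integrable_addExp μ t)]
  have := norm_integral_le_of_norm_le_const (μ := μ)
    (f := fun x => addExp (s * x) - addExp (t * x)) (C := 2 * Real.pi * |s - t|) ?_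
  · simpa using this
  · filter_upwards [hμ.support] with x hx
    refine (norm_addExp_sub_addExp_le _ _).trans ?_
    rw [← sub_mul, abs_mul, abs_of_nonneg hx.1]
    have := mul_le_of_le_one_right (abs_nonneg (s - t)) hx.2
    have := Real.two_pi_pos
    gcongr

end IsCantorMeasure

/-- The distance from `x` to the nearest integer. -/
def distInt (x : ℝ) : ℝ := |x - round x|

/-- The `1`-periodic tent function of height and half-width `a`. -/
def tent (a x : ℝ) : ℝ := max 0 (a - distInt x)

lemma distInt_nonneg (x : ℝ) : 0 ≤ distInt x := abs_nonneg _

lemma distInt_le_half (x : ℝ) : distInt x ≤ 1 / 2 := abs_sub_round x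

lemma distInt_le (x : ℝ) (z : ℤ) : distInt x ≤ |x - z| := round_le x z

lemma cos_two_pi_mul_distInt (n : ℕ) (x : ℝ) :
    Real.cos (2 * Real.pi * n * distInt x) = Real.cos (2 * Real.pi * n * x) := by
  have h : Real.cos (2 * Real.pi * n * (x - round x)) = Real.cos (2 * Real.pi * n * x) := by
    rw [← Real.cos_sub_int_mul_two_pi (2 * Real.pi * n * x) (n * round x)]
    congr 1
    push_cast
    ring
  rw [← h, distInt]
  rcases abs_choice (x - round x) with h' | h' <;> rw [h']
  rw [mul_neg, Real.cos_neg]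

lemma hasSum_cos_bernoulli {x : ℝ} (hx : x ∈ Icc (0 : ℝ) 1) :
    HasSum (fun n : ℕ => 1 / (n : ℝ) ^ 2 * Real.cos (2 * Real.pi * n * x))
      (Real.pi ^ 2 * (x ^ 2 - x + 6⁻¹)) := by
  have h := hasSum_one_div_nat_pow_mul_cos one_ne_zero hx
  have hb := bernoulliFun_two x
  rw [bernoulliFun] at hb
  rw [mul_one, hb] at h
  convert h using 1
  norm_num [Nat.factorial]
  exact Or.inl (by ring)

/-- Fourier expansion of the tent function. -/
lemma hasSum_tent {a : ℝ} (ha : 0 ≤ a) (ha' : a ≤ 1 / 2) (x : ℝ) :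
    HasSum (fun n : ℕ => 2 / Real.pi ^ 2 * (Real.sin (Real.pi * n * a) ^ 2 / (n : ℝ) ^ 2)
      * Real.cos (2 * Real.pi * n * x)) (tent a x - a ^ 2) := by
  set u := distInt x with hu
  have hu0 : 0 ≤ u := distInt_nonneg x
  have hu1 : u ≤ 1 / 2 := distInt_le_half x
  have h1 := hasSum_cos_bernoulli (x := u + a) ⟨by linarith, by linarith⟩
  have h2 := hasSum_cos_bernoulli (x := |u - a|)
    ⟨abs_nonneg _, abs_le.2 ⟨by linarith, by linarith⟩⟩
  have h3 := hasSum_cos_bernoulli (x := u) ⟨by linarith, by linarith⟩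
  have h := ((h1.add h2).sub (h3.mul_left 2)).mul_left (-(1 / (2 * Real.pi ^ 2)))
  have hpi : Real.pi ≠ 0 := Real.pi_ne_zero
  have hv : tent a x - a ^ 2 = -(1 / (2 * Real.pi ^ 2)) *
      (Real.pi ^ 2 * ((u + a) ^ 2 - (u + a) + 6⁻¹) + Real.pi ^ 2 * (|u - a| ^ 2 - |u - a| + 6⁻¹) -
        2 * (Real.pi ^ 2 * (u ^ 2 - u + 6⁻¹))) := by
    rw [tent, ← hu]
    rcases le_total u a with h' | h'
    · rw [max_eq_right (by linarith), abs_of_nonpos (by linarith)]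
      field_simp
      ring
    · rw [max_eq_left (by linarith), abs_of_nonneg (by linarith)]
      field_simp
      ring
  rw [hv]
  refine h.congr_fun ?_
  · intro n
    rw [← cos_two_pi_mul_distInt n x, ← hu]
    have hc2 : Real.cos (2 * Real.pi * n * |u - a|)
        = Real.cos (2 * Real.pi * n * u - 2 * (Real.pi * n * a)) := by
      rcases abs_choice (u - a) with h' | h' <;> rw [h']
      · congr 1; ring
      · rw [mul_neg, Real.cos_neg]; congr 1; ring
    have hc1 : Real.cos (2 * Real.pi * n * (u + a))
        = Real.cos (2 * Real.pi * n * u + 2 * (Real.pi * n * a)) := by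
      congr 1; ring
    rw [hc1, hc2, Real.cos_add, Real.cos_sub, Real.cos_two_mul, Real.sin_sq]
    field_simp
    ring

lemma tent_nonneg (a x : ℝ) : 0 ≤ tent a x := le_max_left _ _

lemma tent_le {a : ℝ} (ha : 0 ≤ a) (x : ℝ) : tent a x ≤ a :=
  max_le ha (by linarith [distInt_nonneg x])

lemma distInt_lt_of_tent_ne_zero {a x : ℝ} (h : tent a x ≠ 0) : distInt x < a := by
  by_contra! h'
  exact h (max_eq_left (by linarith))

lemma distInt_eq_norm (x : ℝ) : distInt x = ‖(x : UnitAddCircle)‖ :=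
  (UnitAddCircle.norm_eq).symm

lemma continuous_distInt : Continuous distInt := by
  have : distInt = fun x : ℝ => ‖(x : UnitAddCircle)‖ := funext distInt_eq_norm
  rw [this]
  exact continuous_norm.comp (AddCircle.continuous_mk' 1)

lemma continuous_tent (a : ℝ) : Continuous (tent a) :=
  continuous_const.max (continuous_const.sub continuous_distInt)

/-- A bound for the `n`-th Fourier coefficient of the tent function. -/
def tentCoeff (a : ℝ) (n : ℕ) : ℝ := min (2 * a ^ 2) (1 / (n : ℝ) ^ 2)

lemma tentCoeff_nonneg (a : ℝ) (n : ℕ) : 0 ≤ tentCoeff a n := by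
  unfold tentCoeff; positivity

lemma summable_tentCoeff (a : ℝ) : Summable (tentCoeff a) :=
  Summable.of_nonneg_of_le (tentCoeff_nonneg a) (fun n => min_le_right _ _)
    (Real.summable_one_div_nat_pow.2 (by norm_num))

lemma abs_coeff_le_tentCoeff (a : ℝ) (n : ℕ) :
    |2 / Real.pi ^ 2 * (Real.sin (Real.pi * n * a) ^ 2 / (n : ℝ) ^ 2)| ≤ tentCoeff a n := by
  have hpi := Real.pi_gt_three
  rw [abs_of_nonneg (by positivity)]
  rcases n.eq_zero_or_pos with rfl | hn
  · simp [tentCoeff]; positivity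
  have hn' : (0 : ℝ) < n := by exact_mod_cast hn
  refine le_min ?_ ?_
  · have : Real.sin (Real.pi * n * a) ^ 2 ≤ (Real.pi * n * a) ^ 2 := by
      rw [sq_le_sq]; exact Real.abs_sin_le_abs
    calc _ ≤ 2 / Real.pi ^ 2 * ((Real.pi * n * a) ^ 2 / (n : ℝ) ^ 2) := by gcongr
      _ = 2 * a ^ 2 := by field_simp
  · have : Real.sin (Real.pi * n * a) ^ 2 ≤ 1 := Real.sin_sq_le_one _
    calc _ ≤ 1 * (1 / (n : ℝ) ^ 2) := by
          gcongr
          rw [div_le_one (by positivity)]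
          nlinarith
      _ = _ := one_mul _

lemma integrable_tent (μ : Measure ℝ) [IsProbabilityMeasure μ] {a : ℝ} (ha : 0 ≤ a) (t s : ℝ) :
    Integrable (fun x => tent a (t * x + s)) μ :=
  Integrable.of_bound ((continuous_tent a).comp (by fun_prop)).aestronglyMeasurable a
    (ae_of_all _ fun x => by
      rw [Real.norm_of_nonneg (tent_nonneg _ _)]; exact tent_le ha _)

lemma abs_integral_cos_le (μ : Measure ℝ) [IsProbabilityMeasure μ] (t s : ℝ) :
    |∫ x, Real.cos (2 * Real.pi * (t * x + s)) ∂μ| ≤ ‖fourierOf μ t‖ := by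
  have h : (∫ x, addExp (t * x + s) ∂μ) = fourierOf μ t * addExp s := by
    simp_rw [addExp_add]
    rw [integral_mul_const, fourierOf]
  have hint : Integrable (fun x => addExp (t * x + s)) μ := by
    simp_rw [addExp_add]
    exact (integrable_addExp μ t).mul_const _
  have hre : ∫ x, Real.cos (2 * Real.pi * (t * x + s)) ∂μ = (fourierOf μ t * addExp s).re := by
    rw [← h]
    simp_rw [← re_addExp]
    exact integral_re hint
  rw [hre]
  refine (Complex.abs_re_le_norm _).trans ?_
  simp

lemma abs_integral_tent_sub_le (μ : Measure ℝ) [IsProbabilityMeasure μ] {a : ℝ} (ha : 0 ≤ a)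
    (ha' : a ≤ 1 / 2) (t s : ℝ) :
    |∫ x, tent a (t * x + s) ∂μ - a ^ 2| ≤ ∑' n : ℕ, tentCoeff a n * ‖fourierOf μ (n * t)‖ := by
  let F : ℕ → ℝ → ℝ := fun n x => 2 / Real.pi ^ 2 * (Real.sin (Real.pi * n * a) ^ 2 / (n : ℝ) ^ 2)
      * Real.cos (2 * Real.pi * n * (t * x + s))
  have hFb : ∀ n x, ‖F n x‖ ≤ tentCoeff a n := fun n x => by
    rw [Real.norm_eq_abs, abs_mul]
    exact (mul_le_of_le_one_right (abs_nonneg _) (Real.abs_cos_le_one _)).trans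
      (abs_coeff_le_tentCoeff a n)
  have hFi : ∀ n, Integrable (F n) μ := fun n =>
    Integrable.of_bound (by fun_prop) (tentCoeff a n) (ae_of_all _ (hFb n))
  have hFs : Summable fun n => ∫ x, ‖F n x‖ ∂μ := by
    refine Summable.of_nonneg_of_le (fun n => integral_nonneg fun x => norm_nonneg _) (fun n => ?_)
      (summable_tentCoeff a)
    have := integral_mono (hFi n).norm (integrable_const (tentCoeff a n)) (hFb n)
    simpa using this
  have hsum := hasSum_integral_of_summable_integral_norm hFi hFs
  have htsum : ∀ x, ∑' n, F n x = tent a (t * x + s) - a ^ 2 :=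
    fun x => (hasSum_tent ha ha' (t * x + s)).tsum_eq
  simp_rw [htsum] at hsum
  rw [integral_sub (integrable_tent μ ha t s) (integrable_const _)] at hsum
  simp only [integral_const, probReal_univ, one_smul] at hsum
  have hterm : ∀ n, ‖∫ x, F n x ∂μ‖ ≤ tentCoeff a n * ‖fourierOf μ (n * t)‖ := fun n => by
    simp only [F]
    rw [integral_const_mul, norm_mul]
    have h1 := abs_integral_cos_le μ (n * t) (n * s)
    have h2 : ∀ x, 2 * Real.pi * n * (t * x + s) = 2 * Real.pi * (n * t * x + n * s) := fun x => by
      ring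
    simp_rw [h2]
    exact mul_le_mul (abs_coeff_le_tentCoeff a n) h1 (norm_nonneg _) (tentCoeff_nonneg a n)
  rw [← hsum.tsum_eq, ← Real.norm_eq_abs]
  refine tsum_of_norm_bounded (Summable.hasSum ?_) hterm
  refine Summable.of_nonneg_of_le (fun n => mul_nonneg (tentCoeff_nonneg a n) (norm_nonneg _))
    (fun n => ?_) (summable_tentCoeff a)
  exact mul_le_of_le_one_right (tentCoeff_nonneg a n) (norm_fourierOf_le_one μ _)

lemma sum_range_mul_eq {M : Type*} [AddCommMonoid M] (f : ℕ → M) (a b : ℕ) :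
    ∑ ν ∈ Finset.range (a * b), f ν
      = ∑ j ∈ Finset.range b, ∑ ν ∈ Finset.range a, f (ν + a * j) := by
  induction b with
  | zero => simp
  | succ b ih =>
    rw [mul_add, mul_one, Finset.sum_range_add, ih, Finset.sum_range_succ]
    simp only [add_comm]

/-- `Λ` bounds the sums of `|digitSum D|` over all shifts of the grid `ℤ / B`. -/
def DigitSumBound (B : ℕ) (D : Finset ℕ) (Λ : ℝ) : Prop :=
  ∀ θ : ℝ, 0 ≤ θ → θ < 1 → ∑ j ∈ Finset.range B, ‖digitSum D ((θ + j) / B)‖ ≤ Λ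

section

variable {B : ℕ} {D : Finset ℕ} {Λ : ℝ}

lemma DigitSumBound.nonneg (h : DigitSumBound B D Λ) : 0 ≤ Λ :=
  (Finset.sum_nonneg fun _ _ => norm_nonneg _).trans (h 0 le_rfl one_pos)

lemma norm_digitSum_add_mul (hB : 2 ≤ B) {i L : ℕ} (hi : i ≤ L) (ν j : ℕ) :
    ‖digitSum D (((ν + B ^ L * j : ℕ) : ℝ) / (B : ℝ) ^ i)‖
      = ‖digitSum D ((ν : ℝ) / (B : ℝ) ^ i)‖ := by
  have hB' : (B : ℝ) ≠ 0 := by positivity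
  have h : ((ν + B ^ L * j : ℕ) : ℝ) / (B : ℝ) ^ i
      = (ν : ℝ) / (B : ℝ) ^ i + ((B ^ (L - i) * j : ℕ) : ℤ) := by
    obtain ⟨k, rfl⟩ := Nat.exists_eq_add_of_le hi
    rw [Nat.add_sub_cancel_left]
    push_cast
    rw [pow_add]
    field_simp
  rw [h, digitSum_add_int]

lemma DigitSumBound.sum_prod_le (h : DigitSumBound B D Λ) (hB : 2 ≤ B) (N M : ℕ) :
    ∑ ν ∈ Finset.range (B ^ (N + M)),
      ∏ i ∈ Finset.range M, ‖digitSum D ((ν : ℝ) / (B : ℝ) ^ (N + i + 1))‖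
        ≤ (B : ℝ) ^ N * Λ ^ M := by
  have hB' : (0 : ℝ) < B := by positivity
  induction M with
  | zero => simp
  | succ M ih =>
    rw [← add_assoc, pow_succ, sum_range_mul_eq, Finset.sum_comm, pow_succ, ← mul_assoc]
    refine le_trans ?_ (mul_le_mul_of_nonneg_right ih h.nonneg)
    rw [Finset.sum_mul]
    refine Finset.sum_le_sum fun ν hν => ?_
    have hν' : ν < B ^ (N + M) := Finset.mem_range.1 hν
    have hsplit : ∀ j ∈ Finset.range B,
        ∏ i ∈ Finset.range (M + 1),
          ‖digitSum D (((ν + B ^ (N + M) * j : ℕ) : ℝ) / (B : ℝ) ^ (N + i + 1))‖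
        = (∏ i ∈ Finset.range M, ‖digitSum D ((ν : ℝ) / (B : ℝ) ^ (N + i + 1))‖)
          * ‖digitSum D (((ν : ℝ) / (B : ℝ) ^ (N + M) + j) / B)‖ := fun j _ => by
      rw [Finset.prod_range_succ]
      congr 1
      · refine Finset.prod_congr rfl fun i hi => norm_digitSum_add_mul hB ?_ ν j
        have := Finset.mem_range.1 hi
        omega
      · congr 2
        push_cast
        rw [pow_succ]
        field_simp
    rw [Finset.sum_congr rfl hsplit, ← Finset.mul_sum]
    refine mul_le_mul_of_nonneg_left (h _ (by positivity) ?_)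
      (Finset.prod_nonneg fun _ _ => norm_nonneg _)
    rw [div_lt_one (by positivity)]
    exact_mod_cast hν'

/-- The mean value over a block of the Fourier transform of a Cantor measure. -/
lemma IsCantorMeasure.sum_norm_fourierOf_le {μ : Measure ℝ} (hμ : IsCantorMeasure B D μ)
    (h : DigitSumBound B D Λ) (hB : 2 ≤ B) (N M j : ℕ) :
    ∑ ν ∈ Finset.range (B ^ (N + M)),
      ‖fourierOf μ (((ν + B ^ (N + M) * j : ℕ) : ℝ) / (B : ℝ) ^ N)‖ ≤ (B : ℝ) ^ N * Λ ^ M := by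
  refine le_trans (Finset.sum_le_sum fun ν _ => ?_) (h.sum_prod_le hB N M)
  refine (hμ.norm_fourierOf_le_prod _ M).trans (le_of_eq (Finset.prod_congr rfl fun i hi => ?_))
  rw [div_div, ← pow_add, ← add_assoc]
  refine norm_digitSum_add_mul hB ?_ ν j
  have := Finset.mem_range.1 hi
  omega

lemma norm_sum_addExp_le {t : ℝ} (ht0 : 0 < t) (ht1 : t < 1) (B : ℕ) :
    ‖∑ d ∈ Finset.range B, addExp (t * d)‖ ≤ 1 / (2 * t) + 1 / (2 * (1 - t)) := by
  have hpow : ∀ d : ℕ, addExp (t * d) = addExp t ^ d := fun d => by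
    rw [addExp, addExp, ← Complex.exp_nat_mul]
    congr 1
    push_cast
    ring
  have hsin : ‖addExp t - 1‖ = 2 * Real.sin (Real.pi * t) := by
    rw [addExp, mul_comm _ Complex.I, Complex.norm_exp_I_mul_ofReal_sub_one, norm_mul,
      Real.norm_of_nonneg zero_le_two, Real.norm_of_nonneg]
    · congr 2; ring
    · refine Real.sin_nonneg_of_nonneg_of_le_pi ?_ ?_ <;> nlinarith [Real.pi_pos]
  have hlow : min t (1 - t) ≤ Real.sin (Real.pi * t) / 2 := by
    have hpi := Real.pi_pos
    rcases le_total t (1 / 2) with h | h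
    · have := Real.mul_le_sin (x := Real.pi * t) (by positivity) (by nlinarith)
      have h2 : 2 / Real.pi * (Real.pi * t) = 2 * t := by field_simp
      rw [h2] at this
      exact (min_le_left _ _).trans (by linarith)
    · have := Real.mul_le_sin (x := Real.pi - Real.pi * t) (by nlinarith) (by nlinarith)
      have h2 : 2 / Real.pi * (Real.pi - Real.pi * t) = 2 * (1 - t) := by field_simp
      rw [h2, Real.sin_pi_sub] at this
      exact (min_le_right _ _).trans (by linarith)
  have hmin : 0 < min t (1 - t) := lt_min ht0 (by linarith)
  have hne : addExp t ≠ 1 := fun h => by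
    rw [h] at hsin
    simp at hsin
    linarith
  have hsum : ∑ d ∈ Finset.range B, addExp (t * d) = (addExp t ^ B - 1) / (addExp t - 1) := by
    simp_rw [hpow]
    exact geom_sum_eq hne B
  rw [hsum, norm_div, hsin]
  have hnum : ‖addExp t ^ B - 1‖ ≤ 2 := by
    refine (norm_sub_le _ _).trans ?_
    simp
    norm_num
  calc ‖addExp t ^ B - 1‖ / (2 * Real.sin (Real.pi * t))
      ≤ 2 / (2 * (2 * min t (1 - t))) := by gcongr; linarith
    _ = 1 / (2 * min t (1 - t)) := by field_simp
    _ ≤ 1 / (2 * t) + 1 / (2 * (1 - t)) := by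
      have h1 : 0 ≤ 1 / (2 * t) := by positivity
      have h2 : 0 ≤ 1 / (2 * (1 - t)) := div_nonneg zero_le_one (by linarith)
      rcases min_choice t (1 - t) with h | h <;> rw [h] <;> linarith

lemma sum_range_inv_le (B : ℕ) : ∑ j ∈ Finset.range B, (1 : ℝ) / j ≤ 1 + Real.log B := by
  rcases B.eq_zero_or_pos with rfl | hB
  · simp
  have h := harmonic_le_one_add_log B
  refine le_trans ?_ h
  rw [harmonic]
  push_cast
  obtain ⟨C, rfl⟩ : ∃ C, B = C + 1 := ⟨B - 1, by omega⟩
  rw [Finset.sum_range_succ', Finset.sum_range_succ]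
  simp
  positivity

lemma sum_norm_sum_addExp_le (hB : 2 ≤ B) {θ : ℝ} (hθ0 : 0 ≤ θ) (hθ1 : θ < 1) :
    ∑ j ∈ Finset.range B, ‖∑ d ∈ Finset.range B, addExp ((θ + j) / B * d)‖
      ≤ B * (3 + Real.log B) := by
  have hB' : (0 : ℝ) < B := by positivity
  have hterm : ∀ j ∈ Finset.range B, ‖∑ d ∈ Finset.range B, addExp ((θ + j) / B * d)‖
      ≤ ((if j = 0 then (B : ℝ) else 0) + if j = B - 1 then (B : ℝ) else 0)
        + (B / 2 * (1 / (j : ℝ)) + B / 2 * (1 / ((B - 1 - j : ℕ) : ℝ))) := fun j hj => by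
    have hj' := Finset.mem_range.1 hj
    have htriv : ‖∑ d ∈ Finset.range B, addExp ((θ + j) / B * d)‖ ≤ B :=
      (norm_sum_le _ _).trans (by simp)
    have hpos : 0 ≤ B / 2 * (1 / (j : ℝ)) + B / 2 * (1 / ((B - 1 - j : ℕ) : ℝ)) := by positivity
    by_cases h0 : j = 0
    · rw [if_pos h0]
      have : (0 : ℝ) ≤ if j = B - 1 then (B : ℝ) else 0 := by split_ifs <;> positivity
      linarith
    by_cases h1 : j = B - 1
    · rw [if_pos h1, if_neg h0]
      linarith
    rw [if_neg h0, if_neg h1, zero_add, zero_add]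
    have hj0 : (0 : ℝ) < j := by exact_mod_cast Nat.pos_of_ne_zero h0
    have hk0 : (0 : ℝ) < (B - 1 - j : ℕ) := by exact_mod_cast (by omega : 0 < B - 1 - j)
    have hk : ((B - 1 - j : ℕ) : ℝ) = B - 1 - j := by
      rw [Nat.cast_sub (by omega), Nat.cast_sub (by omega)]; simp
    have ht1 : (j : ℝ) / B ≤ (θ + j) / B := by gcongr; linarith
    have ht2 : ((B - 1 - j : ℕ) : ℝ) / B ≤ 1 - (θ + j) / B := by
      rw [hk, div_le_iff₀ hB', sub_mul, div_mul_cancel₀ _ hB'.ne']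
      linarith
    have hp1 : 0 < (j : ℝ) / B := by positivity
    have hp2 : 0 < ((B - 1 - j : ℕ) : ℝ) / B := by positivity
    refine (norm_sum_addExp_le (by linarith) (by linarith) B).trans ?_
    have e1 : B / 2 * (1 / (j : ℝ)) = 1 / (2 * ((j : ℝ) / B)) := by field_simp
    have e2 : B / 2 * (1 / ((B - 1 - j : ℕ) : ℝ)) = 1 / (2 * (((B - 1 - j : ℕ) : ℝ) / B)) := by
      field_simp
    rw [e1, e2]
    gcongr
  refine (Finset.sum_le_sum hterm).trans ?_
  rw [Finset.sum_add_distrib, Finset.sum_add_distrib, Finset.sum_add_distrib, ← Finset.mul_sum,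
    ← Finset.mul_sum, Finset.sum_range_reflect (fun j => (1 : ℝ) / (j : ℝ)) B]
  have h := sum_range_inv_le B
  have hs1 : ∑ j ∈ Finset.range B, (if j = 0 then (B : ℝ) else 0) = B := by
    rw [Finset.sum_ite_eq' (Finset.range B) 0, if_pos (by simp; omega)]
  have hs2 : ∑ j ∈ Finset.range B, (if j = B - 1 then (B : ℝ) else 0) = B := by
    rw [Finset.sum_ite_eq' (Finset.range B) (B - 1), if_pos (by simp; omega)]
  rw [hs1, hs2]
  nlinarith

/-- A digit set missing few digits has small digit sums on average. -/
lemma digitSumBound_of_card (hB : 2 ≤ B) (hDB : ∀ d ∈ D, d < B) {r : ℕ}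
    (hr : B ≤ D.card + r) (hD : B ≤ 2 * D.card) :
    DigitSumBound B D (2 * (3 + Real.log B + r)) := by
  intro θ hθ0 hθ1
  have hB' : (0 : ℝ) < B := by positivity
  have hDc : (0 : ℝ) < D.card := by exact_mod_cast (by omega : 0 < D.card)
  have hsub : D ⊆ Finset.range B := fun d hd => Finset.mem_range.2 (hDB d hd)
  have hterm : ∀ t : ℝ, ‖digitSum D t‖ ≤
      2 / B * (‖∑ d ∈ Finset.range B, addExp (t * d)‖ + r) := fun t => by
    have hsd := Finset.sum_sdiff hsub (f := fun d : ℕ => addExp (t * d))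
    have hcard : ((Finset.range B \ D).card : ℝ) ≤ r := by
      rw [Finset.card_sdiff_of_subset hsub, Finset.card_range]
      exact_mod_cast (by omega : B - D.card ≤ r)
    have hrem : ‖∑ d ∈ Finset.range B \ D, addExp (t * d)‖ ≤ r :=
      (norm_sum_le _ _).trans (by simpa using hcard)
    have heq : ∑ d ∈ D, addExp (t * d) = ∑ d ∈ Finset.range B, addExp (t * d)
        - ∑ d ∈ Finset.range B \ D, addExp (t * d) := by rw [← hsd]; ring
    rw [digitSum, norm_mul, norm_inv, Complex.norm_natCast, heq]
    refine mul_le_mul ?_ ((norm_sub_le _ _).trans (by linarith)) (norm_nonneg _) (by positivity)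
    rw [inv_eq_one_div, div_le_div_iff₀ hDc hB', one_mul]
    exact_mod_cast hD
  refine (Finset.sum_le_sum fun j _ => hterm _).trans ?_
  rw [← Finset.mul_sum, Finset.sum_add_distrib, Finset.sum_const, Finset.card_range, nsmul_eq_mul]
  have h := sum_norm_sum_addExp_le hB hθ0 hθ1
  calc _ ≤ 2 / B * (B * (3 + Real.log B) + B * r) := by gcongr
    _ = _ := by field_simp

end

lemma succ_pow_three_le_two_pow (a : ℕ) : (a + 1) ^ 3 ≤ 8 * 2 ^ a := by
  rcases le_or_gt a 3 with h | h
  · interval_cases a <;> norm_num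
  · induction a, h using Nat.le_induction with
    | base => norm_num
    | succ a ha ih =>
      rw [pow_succ 2 a]
      nlinarith [ha, ih, sq_nonneg (a : ℤ), Nat.mul_le_mul ha ha]

lemma succ_pow_three_le {p : ℕ} (hp : 2 ≤ p) (a : ℕ) :
    (a + 1) ^ 3 ≤ (if p < 8 then 8 else 1) * p ^ a := by
  split_ifs with h
  · exact (succ_pow_three_le_two_pow a).trans (by gcongr)
  · have h1 : a + 1 ≤ 2 ^ a := Nat.lt_two_pow_self
    calc (a + 1) ^ 3 ≤ (2 ^ a) ^ 3 := by gcongr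
      _ = 8 ^ a := by rw [← pow_mul, mul_comm, pow_mul]; norm_num
      _ ≤ p ^ a := by gcongr; omega
      _ = 1 * p ^ a := (one_mul _).symm

lemma card_divisors_pow_three_le {ν : ℕ} (hν : ν ≠ 0) : ν.divisors.card ^ 3 ≤ 256 ^ 3 * ν := by
  rw [Nat.card_divisors hν, ← Finset.prod_pow]
  have hprod : ∏ p ∈ ν.primeFactors, p ^ ν.factorization p = ν :=
    Nat.prod_factorization_pow_eq_self hν
  refine (Finset.prod_le_prod' fun p hp =>
    succ_pow_three_le (Nat.prime_of_mem_primeFactors hp).two_le _).trans ?_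
  rw [Finset.prod_mul_distrib, hprod]
  refine Nat.mul_le_mul_right _ ?_
  rw [Finset.prod_ite, Finset.prod_const, Finset.prod_const_one, mul_one]
  have hcard : (ν.primeFactors.filter (· < 8)).card ≤ 8 := by
    have : ν.primeFactors.filter (· < 8) ⊆ Finset.range 8 := fun p hp =>
      Finset.mem_range.2 (Finset.mem_filter.1 hp).2
    simpa using Finset.card_le_card this
  exact (Nat.pow_le_pow_right (by norm_num) hcard).trans (by norm_num)

lemma card_divisors_le (ν : ℕ) : (ν.divisors.card : ℝ) ≤ 256 * (ν : ℝ) ^ (1 / 3 : ℝ) := by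
  rcases eq_or_ne ν 0 with rfl | hν
  · simp
  have h : (ν.divisors.card : ℝ) ^ 3 ≤ 256 ^ 3 * ν := by
    exact_mod_cast card_divisors_pow_three_le hν
  refine le_of_pow_le_pow_left₀ three_ne_zero (by positivity) (h.trans (le_of_eq ?_))
  rw [mul_pow, ← Real.rpow_natCast ((ν : ℝ) ^ (1 / 3 : ℝ)), ← Real.rpow_mul (by positivity)]
  norm_num

lemma sum_sum_mul_le {h : ℕ → ℝ} (h0 : h 0 = 0) (hh : ∀ ν, 0 ≤ h ν) (H Q : ℕ) :
    ∑ n ∈ Finset.range H, ∑ q ∈ Finset.Ioc 0 Q, h (n * q)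
      ≤ ∑ ν ∈ Finset.range (H * Q + 1), (ν.divisors.card : ℝ) * h ν := by
  rw [← Finset.sum_product',
    ← Finset.sum_fiberwise_of_maps_to (g := fun z : ℕ × ℕ => z.1 * z.2)
      (t := Finset.range (H * Q + 1))]
  · refine Finset.sum_le_sum fun ν _ => ?_
    rcases eq_or_ne ν 0 with rfl | hν
    · rw [h0, mul_zero]
      refine (Finset.sum_eq_zero fun z hz => ?_).le
      rw [(Finset.mem_filter.1 hz).2, h0]
    rw [Finset.sum_congr rfl fun z hz => by rw [(Finset.mem_filter.1 hz).2], Finset.sum_const,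
      nsmul_eq_mul]
    refine mul_le_mul_of_nonneg_right (Nat.cast_le.2 ?_) (hh ν)
    refine Finset.card_le_card_of_injOn Prod.snd (fun z hz => ?_) fun z hz z' hz' hzz => ?_
    · exact Nat.mem_divisors.2 ⟨⟨z.1, by rw [mul_comm]; exact (Finset.mem_filter.1 hz).2.symm⟩, hν⟩
    · obtain ⟨hz1, hz2⟩ := Finset.mem_filter.1 hz
      have hz2' := (Finset.mem_filter.1 hz').2
      have hpos : 0 < z.2 := (Finset.mem_Ioc.1 (Finset.mem_product.1 hz1).2).1
      refine Prod.ext ?_ hzz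
      rw [← hzz, ← hz2] at hz2'
      exact (Nat.eq_of_mul_eq_mul_right hpos hz2').symm
  · intro z hz
    rw [Finset.mem_product, Finset.mem_range, Finset.mem_Ioc] at hz
    exact Finset.mem_range.2 (Nat.lt_succ_of_le (Nat.mul_le_mul hz.1.le hz.2.2))

lemma min_two_div_sq_le {X : ℕ} (hX : 0 < X) (ν j : ℕ) :
    min 2 (((X : ℝ) / ((ν + X * j : ℕ) : ℝ)) ^ 2) ≤ 8 * ((j : ℝ) + 1) ^ (-2 : ℝ) := by
  have hX' : (0 : ℝ) < X := by exact_mod_cast hX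
  have e : ((j : ℝ) + 1) ^ (-2 : ℝ) = 1 / ((j : ℝ) + 1) ^ 2 := by
    rw [Real.rpow_neg (by positivity)]
    norm_num
  rw [e]
  rcases j.eq_zero_or_pos with rfl | hj
  · exact (min_le_left _ _).trans (by norm_num)
  have hj' : (1 : ℝ) ≤ j := by exact_mod_cast hj
  refine (min_le_right _ _).trans ?_
  have h1 : (X : ℝ) / ((ν + X * j : ℕ) : ℝ) ≤ 1 / j := by
    rw [div_le_div_iff₀ (by positivity) (by positivity)]
    push_cast
    nlinarith [(Nat.cast_nonneg ν : (0 : ℝ) ≤ ν)]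
  calc ((X : ℝ) / ((ν + X * j : ℕ) : ℝ)) ^ 2 ≤ (1 / (j : ℝ)) ^ 2 := by gcongr
    _ ≤ (2 / ((j : ℝ) + 1)) ^ 2 := by
      gcongr ?_ ^ 2
      rw [div_le_div_iff₀ (by positivity) (by positivity)]
      linarith
    _ ≤ 8 * (1 / ((j : ℝ) + 1) ^ 2) := by
      rw [div_pow, mul_one_div]
      gcongr
      norm_num

lemma summable_succ_rpow : Summable fun j : ℕ => ((j : ℝ) + 1) ^ (-(5 / 3) : ℝ) := by
  have h := (summable_nat_add_iff 1).2 (Real.summable_nat_rpow.2 (by norm_num : (-(5 / 3) : ℝ) < -1))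
  exact_mod_cast h

/-- The constant in the divisor-weighted mean value estimate. -/
def divisorConst : ℝ := 2048 * ∑' j : ℕ, ((j : ℝ) + 1) ^ (-(5 / 3) : ℝ)

lemma IsCantorMeasure.sum_card_divisors_mul_le {B : ℕ} {D : Finset ℕ} {Λ : ℝ} {μ : Measure ℝ}
    (hμ : IsCantorMeasure B D μ) (hΛ : DigitSumBound B D Λ) (hB : 2 ≤ B) {N M X : ℕ}
    (hX : X = B ^ (N + M)) (L : ℕ) :
    ∑ ν ∈ Finset.range L, (ν.divisors.card : ℝ) *
        (min 2 (((X : ℝ) / ν) ^ 2) * ‖fourierOf μ ((ν : ℝ) / (B : ℝ) ^ N)‖)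
      ≤ divisorConst * (X : ℝ) ^ (1 / 3 : ℝ) * ((B : ℝ) ^ N * Λ ^ M) := by
  have hX0 : 0 < X := by rw [hX]; positivity
  have hE : 0 ≤ (B : ℝ) ^ N * Λ ^ M := mul_nonneg (by positivity) (pow_nonneg hΛ.nonneg _)
  set f : ℕ → ℝ := fun ν => (ν.divisors.card : ℝ) *
        (min 2 (((X : ℝ) / ν) ^ 2) * ‖fourierOf μ ((ν : ℝ) / (B : ℝ) ^ N)‖) with hf
  have hf0 : ∀ ν, 0 ≤ f ν := fun ν => by positivity
  have hblock : ∀ j, ∑ ν ∈ Finset.range X, f (ν + X * j)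
      ≤ 2048 * ((j : ℝ) + 1) ^ (-(5 / 3) : ℝ) * (X : ℝ) ^ (1 / 3 : ℝ) * ((B : ℝ) ^ N * Λ ^ M) := by
    intro j
    have hmean := hμ.sum_norm_fourierOf_le hΛ hB N M j
    rw [← hX] at hmean
    refine le_trans ?_ (mul_le_mul_of_nonneg_left hmean (by positivity))
    rw [Finset.mul_sum]
    refine Finset.sum_le_sum fun ν hν => ?_
    simp only [hf]
    rw [← mul_assoc]
    refine mul_le_mul_of_nonneg_right ?_ (norm_nonneg _)
    have hνX : ((ν + X * j : ℕ) : ℝ) ≤ ((j : ℝ) + 1) * X := by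
      have : (ν : ℝ) ≤ X := by exact_mod_cast (Finset.mem_range.1 hν).le
      push_cast
      linarith
    have hd : ((ν + X * j).divisors.card : ℝ)
        ≤ 256 * (((j : ℝ) + 1) ^ (1 / 3 : ℝ) * (X : ℝ) ^ (1 / 3 : ℝ)) := by
      refine (card_divisors_le _).trans ?_
      rw [← Real.mul_rpow (by positivity) (by positivity)]
      gcongr
    refine (mul_le_mul hd (min_two_div_sq_le hX0 ν j) (by positivity) (by positivity)).trans
      (le_of_eq ?_)
    have : (-(5 / 3) : ℝ) = 1 / 3 + -2 := by norm_num
    rw [this, Real.rpow_add (by positivity)]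
    ring
  calc ∑ ν ∈ Finset.range L, f ν ≤ ∑ ν ∈ Finset.range (X * L), f ν :=
        Finset.sum_le_sum_of_subset_of_nonneg
          (Finset.range_subset_range.2 (Nat.le_mul_of_pos_left L hX0)) fun ν _ _ => hf0 ν
    _ = ∑ j ∈ Finset.range L, ∑ ν ∈ Finset.range X, f (ν + X * j) := sum_range_mul_eq f X L
    _ ≤ ∑ j ∈ Finset.range L, 2048 * ((j : ℝ) + 1) ^ (-(5 / 3) : ℝ) * (X : ℝ) ^ (1 / 3 : ℝ)
          * ((B : ℝ) ^ N * Λ ^ M) := Finset.sum_le_sum fun j _ => hblock j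
    _ ≤ divisorConst * (X : ℝ) ^ (1 / 3 : ℝ) * ((B : ℝ) ^ N * Λ ^ M) := by
      rw [← Finset.sum_mul, ← Finset.sum_mul, ← Finset.mul_sum, divisorConst]
      gcongr
      exact summable_succ_rpow.sum_le_tsum _ fun j _ => by positivity

/-- The sum over the fractions `p / q` of the tents at `p / q` of height `1` and
half-width `κ`. -/
def fracTent (κ : ℝ) (q : ℕ) (y : ℝ) : ℝ := tent (κ * q) (q * y) / (κ * q)

/-- Signed weights which remove the contribution of the fractions of small denominator. -/
def fracWeight (Q q : ℕ) : ℝ := 1 - if 4 * q ≤ Q then (Q : ℝ) / q else 0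

section

variable {κ y : ℝ} {q Q : ℕ}

lemma fracTent_nonneg (hκ : 0 < κ) : 0 ≤ fracTent κ q y :=
  div_nonneg (tent_nonneg _ _) (by positivity)

lemma fracTent_le_one (hκ : 0 < κ) : fracTent κ q y ≤ 1 :=
  div_le_one_of_le₀ (tent_le (by positivity) _) (by positivity)

lemma abs_sub_round_lt_of_fracTent_ne_zero (h : fracTent κ q y ≠ 0) :
    |q * y - round (q * y)| < κ * q :=
  distInt_lt_of_tent_ne_zero fun h' => h (by rw [fracTent, h', zero_div])

lemma fracTent_ne_zero (hκ : 0 < κ) (hq : 0 < q) {p : ℤ} (h : |q * y - p| < κ * q) :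
    fracTent κ q y ≠ 0 := by
  have hlt : distInt (q * y) < κ * q := (distInt_le _ p).trans_lt h
  have hpos : 0 < tent (κ * q) (q * y) := lt_max_of_lt_right (by linarith)
  have : (0 : ℝ) < q := by exact_mod_cast hq
  exact (div_pos hpos (by positivity)).ne'

lemma abs_fracWeight_le (hq : 0 < q) (hqQ : q ≤ Q) : |fracWeight Q q| ≤ Q / q := by
  have h : (1 : ℝ) ≤ (Q : ℝ) / q := by
    rw [one_le_div (by exact_mod_cast hq)]
    exact_mod_cast hqQ
  unfold fracWeight
  split_ifs
  · rw [abs_of_nonpos (by linarith)]; linarith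
  · simpa using h

/-- The fractions near `y` are all equal to the one with the smallest denominator. -/
lemma exists_forall_fracTent_le (hκ : 0 < κ) (hκQ : 2 * κ * (Q : ℝ) ^ 2 ≤ 1)
    (h : ∃ q ∈ Finset.Ioc 0 Q, fracTent κ q y ≠ 0) :
    ∃ b ∈ Finset.Ioc 0 Q, ∀ q ∈ Finset.Ioc 0 Q, fracTent κ q y ≠ 0 →
      b ∣ q ∧ fracTent κ q y ≤ fracTent κ b y := by
  classical
  have hex : ∃ q, q ∈ Finset.Ioc 0 Q ∧ fracTent κ q y ≠ 0 := h
  set b := Nat.find hex with hb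
  obtain ⟨hbQ, hbne⟩ := Nat.find_spec hex
  rw [← hb] at hbQ hbne
  have hmin : ∀ q, q ∈ Finset.Ioc 0 Q → fracTent κ q y ≠ 0 → b ≤ q :=
    fun q hq hq' => Nat.find_min' hex ⟨hq, hq'⟩
  obtain ⟨hb0, hbQ'⟩ := Finset.mem_Ioc.1 hbQ
  have hb0' : (0 : ℝ) < b := by exact_mod_cast hb0
  have hblt := abs_sub_round_lt_of_fracTent_ne_zero hbne
  set p := round ((b : ℝ) * y) with hp
  have hcop : IsCoprime (b : ℤ) p := by
    rw [Int.isCoprime_iff_gcd_eq_one]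
    by_contra hg
    set g := Int.gcd (b : ℤ) p with hgdef
    have hg0 : 0 < g := Int.gcd_pos_of_ne_zero_left _ (by exact_mod_cast hb0.ne')
    obtain ⟨b', hb'⟩ : g ∣ b := Int.natCast_dvd_natCast.1 (Int.gcd_dvd_left _ _)
    obtain ⟨p', hp'⟩ : (g : ℤ) ∣ p := Int.gcd_dvd_right _ _
    have hb'0 : 0 < b' := Nat.pos_of_ne_zero fun h => by rw [h, mul_zero] at hb'; omega
    have hg2 : 2 ≤ g := by omega
    have hb'b : b' < b := by rw [hb']; nlinarith
    have hgR : (0 : ℝ) < g := by exact_mod_cast hg0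
    refine absurd (hmin b' (Finset.mem_Ioc.2 ⟨hb'0, by omega⟩)
      (fracTent_ne_zero hκ hb'0 (p := p') ?_)) (by omega)
    rw [hp', hb'] at hblt
    push_cast at hblt
    rw [show (g : ℝ) * b' * y - g * p' = g * (b' * y - p') by ring, abs_mul, abs_of_pos hgR,
      show κ * ((g : ℝ) * b') = g * (κ * b') by ring] at hblt
    exact lt_of_mul_lt_mul_left hblt hgR.le
  refine ⟨b, hbQ, fun q hq hqne => ?_⟩
  obtain ⟨hq0, hqQ⟩ := Finset.mem_Ioc.1 hq
  have hq0' : (0 : ℝ) < q := by exact_mod_cast hq0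
  have hqlt := abs_sub_round_lt_of_fracTent_ne_zero hqne
  set p' := round ((q : ℝ) * y) with hp'
  have heq : p' * b = p * q := by
    have hlt : |((p' * b - p * q : ℤ) : ℝ)| < 1 := by
      have e : ((p' * b - p * q : ℤ) : ℝ) = q * (b * y - p) - b * (q * y - p') := by
        push_cast; ring
      have h1 : |(q : ℝ) * (b * y - p)| < κ * (q * b) := by
        rw [abs_mul, abs_of_pos hq0']; nlinarith
      have h2 : |(b : ℝ) * (q * y - p')| < κ * (q * b) := by
        rw [abs_mul, abs_of_pos hb0']; nlinarith
      have h3 : (q : ℝ) * b ≤ (Q : ℝ) ^ 2 := by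
        rw [sq]
        exact mul_le_mul (by exact_mod_cast hqQ) (by exact_mod_cast hbQ') hb0'.le (by positivity)
      rw [e]
      refine (abs_sub _ _).trans_lt ?_
      nlinarith
    have := Int.abs_lt_one_iff.1 (by exact_mod_cast hlt : |p' * (b : ℤ) - p * q| < 1)
    linarith
  have hdvd : (b : ℤ) ∣ q := hcop.dvd_of_dvd_mul_left ⟨p', by linarith⟩
  obtain ⟨e, he⟩ := Int.natCast_dvd_natCast.1 hdvd
  refine ⟨⟨e, he⟩, ?_⟩
  have he0 : 0 < e := Nat.pos_of_ne_zero fun h => by rw [h, mul_zero] at he; omega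
  have he0' : (0 : ℝ) < e := by exact_mod_cast he0
  have hp'e : p' = e * p := by
    rw [he] at heq
    push_cast at heq
    have : (b : ℤ) * p' = b * (e * p) := by linarith
    exact mul_left_cancel₀ (by exact_mod_cast hb0.ne') this
  have hdist : distInt (q * y) = e * distInt (b * y) := by
    rw [distInt, distInt, ← hp', ← hp, hp'e, he]
    push_cast
    rw [show (b : ℝ) * e * y - e * p = e * (b * y - p) by ring, abs_mul, abs_of_pos he0']
  have htent : tent (κ * q) (q * y) = e * tent (κ * b) (b * y) := by
    rw [tent, tent, hdist, mul_max_of_nonneg _ _ he0'.le, mul_zero, he]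
    congr 1
    push_cast
    ring
  refine le_of_eq ?_
  rw [fracTent, fracTent, htent, he]
  push_cast
  field_simp

lemma sum_fracWeight_mul_fracTent_le (hκ : 0 < κ) (hκQ : 2 * κ * (Q : ℝ) ^ 2 ≤ 1) :
    ∑ q ∈ Finset.Ioc 0 Q, fracWeight Q q * fracTent κ q y ≤ 4 := by
  by_cases h : ∃ q ∈ Finset.Ioc 0 Q, fracTent κ q y ≠ 0
  swap
  · push Not at h
    rw [Finset.sum_eq_zero fun q hq => by rw [h q hq, mul_zero]]
    norm_num
  obtain ⟨b, hb, hdom⟩ := exists_forall_fracTent_le hκ hκQ h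
  obtain ⟨hb0, hbQ⟩ := Finset.mem_Ioc.1 hb
  have hb0' : (0 : ℝ) < b := by exact_mod_cast hb0
  have h0 : 0 ≤ fracTent κ b y := fracTent_nonneg hκ
  have h1 : fracTent κ b y ≤ 1 := fracTent_le_one hκ
  have hsum : ∑ q ∈ Finset.Ioc 0 Q, fracTent κ q y ≤ Q / b * fracTent κ b y := by
    have hle : ∀ q ∈ Finset.Ioc 0 Q, fracTent κ q y ≤ if b ∣ q then fracTent κ b y else 0 := by
      intro q hq
      by_cases hq0 : fracTent κ q y = 0
      · rw [hq0]; split_ifs <;> [exact h0; exact le_rfl]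
      · rw [if_pos (hdom q hq hq0).1]; exact (hdom q hq hq0).2
    refine (Finset.sum_le_sum hle).trans ?_
    rw [← Finset.sum_filter, Finset.sum_const, Nat.Ioc_filter_dvd_card_eq_div, nsmul_eq_mul]
    exact mul_le_mul_of_nonneg_right Nat.cast_div_le h0
  simp only [fracWeight, sub_mul, one_mul, Finset.sum_sub_distrib]
  have hnn : ∀ q ∈ Finset.Ioc 0 Q, 0 ≤ (if 4 * q ≤ Q then (Q : ℝ) / q else 0) * fracTent κ q y :=
    fun q _ => mul_nonneg (by split_ifs <;> positivity) (fracTent_nonneg hκ)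
  by_cases h4 : 4 * b ≤ Q
  · have := Finset.single_le_sum hnn hb
    rw [if_pos h4] at this
    linarith
  · have h5 := Finset.sum_nonneg hnn
    have h6 : (Q : ℝ) / b ≤ 4 := by
      rw [div_le_iff₀ hb0']
      exact_mod_cast (by omega : Q ≤ 4 * b)
    nlinarith

lemma sum_fracWeight_mul_ge : (Q : ℝ) ^ 2 / 4 ≤ ∑ q ∈ Finset.Ioc 0 Q, fracWeight Q q * q := by
  have h1 : ∑ q ∈ Finset.Ioc 0 Q, (q : ℝ) = Q * (Q + 1) / 2 := by
    induction Q with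
    | zero => simp
    | succ Q ih =>
      rw [← Finset.insert_Ioc_right_eq_Ioc_add_one (Nat.zero_le Q), Finset.sum_insert (by simp), ih]
      push_cast
      ring
  have h2 : ∑ q ∈ Finset.Ioc 0 Q, (if 4 * q ≤ Q then (Q : ℝ) / q else 0) * q ≤ (Q : ℝ) ^ 2 / 4 := by
    have hterm : ∀ q ∈ Finset.Ioc 0 Q, (if 4 * q ≤ Q then (Q : ℝ) / q else 0) * q
        = if 4 * q ≤ Q then (Q : ℝ) else 0 := fun q hq => by
      have : (q : ℝ) ≠ 0 := by exact_mod_cast (Finset.mem_Ioc.1 hq).1.ne'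
      split_ifs
      · field_simp
      · simp
    rw [Finset.sum_congr rfl hterm, ← Finset.sum_filter, Finset.sum_const, nsmul_eq_mul]
    have hsub : (Finset.Ioc 0 Q).filter (fun q => 4 * q ≤ Q) ⊆ Finset.Ioc 0 (Q / 4) := fun q hq => by
      rw [Finset.mem_filter, Finset.mem_Ioc] at hq
      rw [Finset.mem_Ioc]
      omega
    have hcard := Finset.card_le_card hsub
    rw [Nat.card_Ioc, Nat.sub_zero] at hcard
    have : (((Finset.Ioc 0 Q).filter (fun q => 4 * q ≤ Q)).card : ℝ) ≤ Q / 4 :=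
      (Nat.cast_le.2 hcard).trans (by simpa using (Nat.cast_div_le : ((Q / 4 : ℕ) : ℝ) ≤ _))
    nlinarith [(Nat.cast_nonneg Q : (0 : ℝ) ≤ Q)]
  simp only [fracWeight, sub_mul, one_mul, Finset.sum_sub_distrib]
  nlinarith [(Nat.cast_nonneg Q : (0 : ℝ) ≤ Q)]

end

/-- The numbers approximable by some fraction `p / q` within `c / q ^ 2`. -/
def approxSet (c : ℝ) : Set ℝ := {y | ∃ (p : ℤ) (q : ℕ), 0 < q ∧ |y - p / q| < c / (q : ℝ) ^ 2}

lemma isOpen_approxSet (c : ℝ) : IsOpen (approxSet c) := by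
  have : approxSet c = ⋃ (p : ℤ) (q : ℕ) (_ : 0 < q), {y : ℝ | |y - p / q| < c / (q : ℝ) ^ 2} := by
    ext y
    simp [approxSet]
  rw [this]
  exact isOpen_iUnion fun p => isOpen_iUnion fun q => isOpen_iUnion fun _ =>
    isOpen_lt (by fun_prop) continuous_const

lemma continuous_fracTent (κ : ℝ) (q : ℕ) : Continuous (fracTent κ q) :=
  ((continuous_tent _).comp (continuous_const_mul _)).div_const _

lemma fracTent_eq_zero_of_notMem {c κ y : ℝ} {q Q : ℕ} (hc : 0 ≤ c)
    (hκ : κ * (Q : ℝ) ^ 2 = c) (hq : q ∈ Finset.Ioc 0 Q) (hy : y ∉ approxSet c) :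
    fracTent κ q y = 0 := by
  by_contra h
  obtain ⟨hq0, hqQ⟩ := Finset.mem_Ioc.1 hq
  have hq0' : (0 : ℝ) < q := by exact_mod_cast hq0
  have hqQ' : (q : ℝ) ≤ Q := by exact_mod_cast hqQ
  have hκ0 : 0 ≤ κ := by
    by_contra! hneg
    have : 0 < (Q : ℝ) ^ 2 := by have := hq0'.trans_le hqQ'; positivity
    nlinarith
  refine hy ⟨round (q * y), q, hq0, ?_⟩
  have hlt := abs_sub_round_lt_of_fracTent_ne_zero h
  rw [lt_div_iff₀ (by positivity)]
  have e : |y - round (q * y) / q| * q = |q * y - round (q * y)| := by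
    rw [← abs_of_pos hq0', ← abs_mul, abs_of_pos hq0']
    congr 1
    field_simp
  calc |y - round (q * y) / q| * (q : ℝ) ^ 2 = |q * y - round (q * y)| * q := by rw [← e]; ring
    _ < κ * q * q := by gcongr
    _ = κ * (q : ℝ) ^ 2 := by ring
    _ ≤ κ * (Q : ℝ) ^ 2 := by gcongr
    _ = c := hκ

namespace IsCantorMeasure

variable {B : ℕ} {D : Finset ℕ} {Λ : ℝ} {μ : Measure ℝ}

lemma integrable_fracTent (hμ : IsCantorMeasure B D μ) {κ : ℝ} (hκ : 0 < κ) (q N w : ℕ) :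
    Integrable (fun x => fracTent κ q (cylMap B N w x)) μ := by
  have := hμ.isProb
  refine Integrable.of_bound
    ((continuous_fracTent κ q).comp (continuous_cylMap B N w)).aestronglyMeasurable 1
    (ae_of_all _ fun x => ?_)
  rw [Real.norm_of_nonneg (fracTent_nonneg hκ)]
  exact fracTent_le_one hκ

lemma abs_fracWeight_mul_integral_sub_le (hμ : IsCantorMeasure B D μ) (hB : 2 ≤ B) {X q Q : ℕ}
    (hX : 0 < X) (hQX : 2 * Q ≤ X) (hq : q ∈ Finset.Ioc 0 Q) (N w : ℕ) :
    |fracWeight Q q * ∫ x, fracTent (1 / X) q (cylMap B N w x) ∂μ - fracWeight Q q * (1 / X * q)|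
      ≤ Q / X * ∑' n : ℕ, min 2 (((X : ℝ) / ((n * q : ℕ) : ℝ)) ^ 2)
          * ‖fourierOf μ (((n * q : ℕ) : ℝ) / (B : ℝ) ^ N)‖ := by
  have := hμ.isProb
  obtain ⟨hq0, hqQ⟩ := Finset.mem_Ioc.1 hq
  have hq0' : (0 : ℝ) < q := by exact_mod_cast hq0
  have hX' : (0 : ℝ) < X := by exact_mod_cast hX
  have hB' : (0 : ℝ) < B := by positivity
  have ha : (1 / X : ℝ) * q ≤ 1 / 2 := by
    rw [one_div_mul_eq_div, div_le_div_iff₀ hX' two_pos]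
    exact_mod_cast (by omega : q * 2 ≤ 1 * X)
  have hint : ∫ x, fracTent (1 / X) q (cylMap B N w x) ∂μ
      = (∫ x, tent (1 / X * q) (q / (B : ℝ) ^ N * x + q * w / (B : ℝ) ^ N) ∂μ) / (1 / X * q) := by
    rw [← integral_div]
    refine integral_congr_ae (ae_of_all _ fun x => ?_)
    simp only [fracTent, cylMap]
    congr 2
    ring
  have hmain := abs_integral_tent_sub_le μ (by positivity) ha (q / (B : ℝ) ^ N)
    (q * w / (B : ℝ) ^ N)
  set I := ∫ x, tent (1 / X * q) (q / (B : ℝ) ^ N * x + q * w / (B : ℝ) ^ N) ∂μ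
  set a : ℝ := 1 / X * q with hadef
  have ha0 : 0 < a := by positivity
  have e : fracWeight Q q * (I / a) - fracWeight Q q * a = fracWeight Q q / a * (I - a ^ 2) := by
    field_simp
  rw [hint, e, abs_mul, abs_div, abs_of_pos ha0]
  refine (mul_le_mul (div_le_div_of_nonneg_right (abs_fracWeight_le hq0 hqQ) ha0.le) hmain
    (abs_nonneg _) (by positivity)).trans (le_of_eq ?_)
  rw [← tsum_mul_left, ← tsum_mul_left]
  refine tsum_congr fun n => ?_
  have e2 : (n : ℝ) * (q / (B : ℝ) ^ N) = ((n * q : ℕ) : ℝ) / (B : ℝ) ^ N := by push_cast; ring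
  have e3 : (Q : ℝ) / q / a * tentCoeff a n
      = Q / X * min 2 (((X : ℝ) / ((n * q : ℕ) : ℝ)) ^ 2) := by
    rw [tentCoeff, mul_min_of_nonneg _ _ (by positivity), mul_min_of_nonneg _ _ (by positivity),
      hadef]
    congr 1
    · field_simp
    · push_cast
      rcases eq_or_ne (n : ℝ) 0 with h | h
      · simp [h]
      · field_simp
  rw [e2, ← mul_assoc, e3, mul_assoc]

lemma sum_tsum_le (hμ : IsCantorMeasure B D μ) (hΛ : DigitSumBound B D Λ) (hB : 2 ≤ B)
    {N M X : ℕ} (hX : X = B ^ (N + M)) (Q : ℕ) :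
    ∑ q ∈ Finset.Ioc 0 Q, ∑' n : ℕ, min 2 (((X : ℝ) / ((n * q : ℕ) : ℝ)) ^ 2)
          * ‖fourierOf μ (((n * q : ℕ) : ℝ) / (B : ℝ) ^ N)‖
      ≤ divisorConst * (X : ℝ) ^ (1 / 3 : ℝ) * ((B : ℝ) ^ N * Λ ^ M) := by
  have := hμ.isProb
  set h : ℕ → ℝ := fun ν => min 2 (((X : ℝ) / ν) ^ 2) * ‖fourierOf μ ((ν : ℝ) / (B : ℝ) ^ N)‖
    with hdef
  have hh : ∀ ν, 0 ≤ h ν := fun ν => by positivity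
  have hsum : ∀ q ∈ Finset.Ioc 0 Q, Summable fun n : ℕ => h (n * q) := fun q hq => by
    have hq0 : (1 : ℝ) ≤ q := by exact_mod_cast (Finset.mem_Ioc.1 hq).1
    refine Summable.of_nonneg_of_le (fun n => hh _) (fun n => ?_)
      ((Real.summable_one_div_nat_pow.2 (by norm_num : 1 < 2)).mul_left ((X : ℝ) ^ 2))
    refine (mul_le_of_le_one_right (by positivity) (norm_fourierOf_le_one μ _)).trans
      ((min_le_right _ _).trans ?_)
    rcases eq_or_ne n 0 with rfl | hn
    · simp
    have hn' : (0 : ℝ) < n := by positivity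
    rw [div_pow, ← mul_one_div]
    push_cast
    gcongr
    nlinarith
  change ∑ q ∈ Finset.Ioc 0 Q, ∑' n : ℕ, h (n * q) ≤ _
  rw [← Summable.tsum_finsetSum hsum]
  refine Real.tsum_le_of_sum_range_le (fun n => Finset.sum_nonneg fun q _ => hh _) fun H => ?_
  refine (sum_sum_mul_le (by simp [hdef]) hh H Q).trans ?_
  exact hμ.sum_card_divisors_mul_le hΛ hB hX _

lemma sub_le_measureReal_approxSet (hμ : IsCantorMeasure B D μ) (hΛ : DigitSumBound B D Λ)
    (hB : 2 ≤ B) {N M X Q w : ℕ} (hX : X = B ^ (N + M)) (hQ : 0 < Q) {c : ℝ} (hc : 0 < c)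
    (hc2 : 2 * c ≤ 1) (hcX : (Q : ℝ) ^ 2 / X = c) :
    c / 4 - Q / X * (divisorConst * (X : ℝ) ^ (1 / 3 : ℝ) * ((B : ℝ) ^ N * Λ ^ M))
      ≤ 4 * μ.real (cylMap B N w ⁻¹' approxSet c) := by
  have := hμ.isProb
  have hX0 : 0 < X := by rw [hX]; positivity
  have hX' : (0 : ℝ) < X := by exact_mod_cast hX0
  have hQ' : (1 : ℝ) ≤ Q := by exact_mod_cast hQ
  have hκ : (0 : ℝ) < 1 / X := by positivity
  have hκQ : 1 / X * (Q : ℝ) ^ 2 = c := by rw [one_div_mul_eq_div, hcX]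
  have hQX : 2 * Q ≤ X := by
    rw [div_eq_iff hX'.ne'] at hcX
    have : (2 * Q : ℝ) ≤ X := by nlinarith
    exact_mod_cast this
  have hmeas : MeasurableSet (cylMap B N w ⁻¹' approxSet c) :=
    measurable_cylMap B N w (isOpen_approxSet c).measurableSet
  have hupper : ∫ x, ∑ q ∈ Finset.Ioc 0 Q, fracWeight Q q * fracTent (1 / X) q (cylMap B N w x) ∂μ
      ≤ 4 * μ.real (cylMap B N w ⁻¹' approxSet c) := by
    have hind : ∫ x, (cylMap B N w ⁻¹' approxSet c).indicator (fun _ => (4 : ℝ)) x ∂μ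
        = 4 * μ.real (cylMap B N w ⁻¹' approxSet c) := by
      rw [integral_indicator_const _ hmeas, smul_eq_mul, mul_comm]
    rw [← hind]
    refine integral_mono
      (integrable_finsetSum _ fun q _ => (hμ.integrable_fracTent hκ q N w).const_mul _)
      ((integrable_const _).indicator hmeas) fun x => ?_
    by_cases hx : x ∈ cylMap B N w ⁻¹' approxSet c
    · rw [indicator_of_mem hx]
      exact sum_fracWeight_mul_fracTent_le hκ (by linarith)
    · rw [indicator_of_notMem hx]
      refine (Finset.sum_eq_zero fun q hq => ?_).le
      rw [fracTent_eq_zero_of_notMem hc.le hκQ hq hx, mul_zero]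
  refine le_trans ?_ hupper
  rw [integral_finsetSum _ fun q _ => (hμ.integrable_fracTent hκ q N w).const_mul _]
  simp_rw [integral_const_mul]
  have hlow : ∀ q ∈ Finset.Ioc 0 Q, _ := fun q hq =>
    (abs_le.1 (hμ.abs_fracWeight_mul_integral_sub_le hB hX0 hQX hq N w)).1
  have hlow' := Finset.sum_le_sum hlow
  rw [Finset.sum_neg_distrib, ← Finset.mul_sum, Finset.sum_sub_distrib] at hlow'
  have h1 := hμ.sum_tsum_le hΛ hB hX Q
  have h2 := mul_le_mul_of_nonneg_left h1 (by positivity : (0 : ℝ) ≤ Q / X)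
  have h3 : c / 4 ≤ ∑ q ∈ Finset.Ioc 0 Q, fracWeight Q q * (1 / X * q) := by
    have e : ∑ q ∈ Finset.Ioc 0 Q, fracWeight Q q * (1 / X * q)
        = 1 / X * ∑ q ∈ Finset.Ioc 0 Q, fracWeight Q q * q := by
      rw [Finset.mul_sum]
      exact Finset.sum_congr rfl fun q _ => by ring
    rw [e, ← hκQ, mul_div_assoc]
    exact mul_le_mul_of_nonneg_left sum_fracWeight_mul_ge hκ.le
  linarith

lemma le_measureReal_approxSet (hμ : IsCantorMeasure B D μ) (hΛ : DigitSumBound B D Λ)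
    (hB : 2 ≤ B) {β : ℝ} (hβ : 1 < β) (hβB : β ^ 12 = B) (hΛβ : Λ ≤ β) {s : ℕ} (hs : 1 ≤ s)
    (N w : ℕ) :
    1 / (B : ℝ) ^ (2 * s) / 16 ≤ μ.real (cylMap B N w ⁻¹' approxSet (1 / (B : ℝ) ^ (2 * s))) := by
  have hB' : (2 : ℝ) ≤ B := by exact_mod_cast hB
  set c : ℝ := 1 / (B : ℝ) ^ (2 * s) with hcdef
  have hc : 0 < c := by positivity
  have hc2 : 2 * c ≤ 1 := by
    rw [hcdef, mul_one_div, div_le_one (by positivity)]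
    calc (2 : ℝ) ≤ B := hB'
      _ = (B : ℝ) ^ 1 := (pow_one _).symm
      _ ≤ (B : ℝ) ^ (2 * s) := pow_le_pow_right₀ (by linarith) (by omega)
  have hC : 0 ≤ divisorConst :=
    mul_nonneg (by norm_num) (tsum_nonneg fun j => by positivity)
  have key : ∀ k, N ≤ k → c / 4 - c * divisorConst * (B : ℝ) ^ N * β ^ (10 * s) * (β⁻¹ ^ 2) ^ k
      ≤ 4 * μ.real (cylMap B N w ⁻¹' approxSet c) := fun k hk => by
    have hNM : N + (2 * (k + s) - N) = 2 * (k + s) := by omega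
    set M := 2 * (k + s) - N with hM
    have h := hμ.sub_le_measureReal_approxSet hΛ hB (N := N) (M := M) (X := B ^ (N + M))
      (Q := B ^ k) (w := w) rfl (by positivity) hc hc2 (by
        rw [hNM, hcdef]
        push_cast
        rw [← pow_mul, div_eq_div_iff (by positivity) (by positivity), ← pow_add, one_mul]
        congr 1
        ring)
    refine le_trans (sub_le_sub_left ?_ _) h
    rw [hNM]
    have hβ0 : 0 < β := by linarith
    have hroot : (((B ^ (2 * (k + s)) : ℕ) : ℝ)) ^ (1 / 3 : ℝ) = β ^ (8 * (k + s)) := by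
      push_cast
      rw [← hβB, ← pow_mul, show 12 * (2 * (k + s)) = 8 * (k + s) * 3 by ring, pow_mul,
        one_div]
      exact Real.pow_rpow_inv_natCast (by positivity) three_ne_zero
    have hΛM : Λ ^ M ≤ β ^ (2 * (k + s)) :=
      (pow_le_pow_left₀ hΛ.nonneg hΛβ M).trans (pow_le_pow_right₀ hβ.le (by omega))
    have hQX : ((B ^ k : ℕ) : ℝ) / ((B ^ (2 * (k + s)) : ℕ) : ℝ) = c * (β⁻¹ ^ 12) ^ k := by
      push_cast
      rw [hcdef, inv_pow, hβB, inv_pow, show 2 * (k + s) = k + k + 2 * s by ring, pow_add, pow_add]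
      field_simp
    rw [hroot, hQX]
    calc c * (β⁻¹ ^ 12) ^ k * (divisorConst * β ^ (8 * (k + s)) * ((B : ℝ) ^ N * Λ ^ M))
        ≤ c * (β⁻¹ ^ 12) ^ k * (divisorConst * β ^ (8 * (k + s))
            * ((B : ℝ) ^ N * β ^ (2 * (k + s)))) := by gcongr
      _ = c * divisorConst * (B : ℝ) ^ N * β ^ (10 * s) * (β⁻¹ ^ 2) ^ k := by
        have : (β⁻¹ ^ 12) ^ k * (β ^ (8 * (k + s)) * β ^ (2 * (k + s)))
            = β ^ (10 * s) * (β⁻¹ ^ 2) ^ k := by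
          rw [← pow_mul, ← pow_mul, inv_pow, inv_pow]
          field_simp
          ring
        linear_combination c * divisorConst * (B : ℝ) ^ N * this
  have hlim : Tendsto (fun k : ℕ => c / 4
      - c * divisorConst * (B : ℝ) ^ N * β ^ (10 * s) * (β⁻¹ ^ 2) ^ k) atTop (nhds (c / 4)) := by
    have h1 : Tendsto (fun k : ℕ => (β⁻¹ ^ 2) ^ k) atTop (nhds 0) := by
      refine tendsto_pow_atTop_nhds_zero_of_lt_one (by positivity) ?_
      exact pow_lt_one₀ (by positivity) (inv_lt_one_of_one_lt₀ hβ) two_ne_zero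
    simpa using (h1.const_mul (c * divisorConst * (B : ℝ) ^ N * β ^ (10 * s))).const_sub (c / 4)
  have := le_of_tendsto hlim (eventually_atTop.2 ⟨N, key⟩)
  linarith

/-- Almost every point for a Cantor measure with few missing digits is well approximable. -/
lemma ae_mem_approxSet (hμ : IsCantorMeasure B D μ) (hDB : ∀ d ∈ D, d < B)
    (hΛ : DigitSumBound B D Λ)
    (hB : 2 ≤ B) {β : ℝ} (hβ : 1 < β) (hβB : β ^ 12 = B) (hΛβ : Λ ≤ β) :
    ∀ᵐ x ∂μ, ∀ c > 0, x ∈ approxSet c := by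
  have := hμ.isProb
  have hB' : (2 : ℝ) ≤ B := by exact_mod_cast hB
  have hall : ∀ s : ℕ, ∀ᵐ x ∂μ, x ∈ approxSet (1 / (B : ℝ) ^ (2 * (s + 1))) := fun s => by
    refine hμ.ae_mem_of_forall_le hB hDB (isOpen_approxSet _).measurableSet
      (c := ENNReal.ofReal (1 / (B : ℝ) ^ (2 * (s + 1)) / 16)) ?_ fun N w _ => ?_
    · exact (ENNReal.ofReal_pos.2 (by positivity)).ne'
    · rw [← ofReal_measureReal]
      exact ENNReal.ofReal_le_ofReal
        (hμ.le_measureReal_approxSet hΛ hB hβ hβB hΛβ (by omega) N w)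
  filter_upwards [ae_all_iff.2 hall] with x hx c hc
  have hlim : Tendsto (fun s : ℕ => (1 / (B : ℝ)) ^ s) atTop (nhds 0) :=
    tendsto_pow_atTop_nhds_zero_of_lt_one (by positivity)
      (by rw [div_lt_one (by positivity)]; linarith)
  obtain ⟨s, hs⟩ := ((tendsto_order.1 hlim).2 c hc).exists
  obtain ⟨p, q, hq, hpq⟩ := hx s
  refine ⟨p, q, hq, hpq.trans_le ?_⟩
  have : (0 : ℝ) < q := by exact_mod_cast hq
  refine div_le_div_of_nonneg_right ?_ (by positivity)
  refine le_trans ?_ hs.le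
  rw [_root_.one_div_pow]
  exact one_div_le_one_div_of_le (by positivity)
    (pow_le_pow_right₀ (by linarith) (by omega))

end IsCantorMeasure

/-- For an irrational ratio of logarithms, the quotients `m ^ k / B ^ j` with large `j` are dense
in the positive half-line. -/
lemma exists_pow_div_pow_near {m B : ℕ} (hm : 2 ≤ m) (hB : 2 ≤ B)
    (hirr : Irrational (Real.log m / Real.log B)) {y δ : ℝ} (hy : 0 < y) (hδ : 0 < δ) (J : ℕ) :
    ∃ k j : ℕ, J ≤ j ∧ |(m : ℝ) ^ k / (B : ℝ) ^ j - y| < δ := by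
  have hm' : (2 : ℝ) ≤ m := by exact_mod_cast hm
  have hB' : (2 : ℝ) ≤ B := by exact_mod_cast hB
  have hlm : 0 < Real.log m := Real.log_pos (by linarith)
  have hlB : 0 < Real.log B := Real.log_pos (by linarith)
  set α := Real.log m / Real.log B with hα
  have hα0 : 0 < α := div_pos hlm hlB
  set u₀ := Real.log y / Real.log B with hu₀
  have hcont : Continuous fun u : ℝ => Real.exp (u * Real.log B) := by fun_prop
  obtain ⟨η, hη, hclose⟩ := Metric.continuousAt_iff.1 (hcont.continuousAt (x := u₀)) δ hδ
  have hval : Real.exp (u₀ * Real.log B) = y := by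
    rw [hu₀, div_mul_cancel₀ _ hlB.ne', Real.exp_log hy]
  obtain ⟨K₀, hK₀⟩ := exists_nat_gt ((J + u₀ + 1) / α)
  have hdense : DenseRange (fun k : ℕ => k • ((α : ℝ) : UnitAddCircle)) :=
    denseRange_zsmul_iff_nsmul.1 (AddCircle.denseRange_zsmul_coe_iff.2 (by simpa using hirr))
  obtain ⟨k', hk'⟩ := Metric.denseRange_iff.1 hdense ((u₀ - K₀ * α : ℝ) : UnitAddCircle) η hη
  have hnorm : distInt (u₀ - (K₀ + k' : ℕ) * α) < η := by
    have e : ((u₀ - (K₀ + k' : ℕ) * α : ℝ) : UnitAddCircle)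
        = ((u₀ - K₀ * α : ℝ) : UnitAddCircle) - k' • ((α : ℝ) : UnitAddCircle) := by
      rw [← AddCircle.coe_nsmul, ← AddCircle.coe_sub]
      congr 1
      push_cast
      rw [nsmul_eq_mul]
      ring
    rw [distInt_eq_norm, e]
    rwa [dist_eq_norm] at hk'
  set k := K₀ + k' with hk
  have hround := abs_sub_round (u₀ - (k : ℝ) * α)
  set z := round (u₀ - (k : ℝ) * α) with hz
  have hkα : (J : ℝ) + u₀ + 1 < k * α := by
    rw [div_lt_iff₀ hα0] at hK₀
    refine hK₀.trans_le ?_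
    gcongr
    omega
  have hzJ : (J : ℝ) ≤ -(z : ℝ) := by
    have := (abs_le.1 hround).1
    have := (abs_le.1 hround).2
    linarith
  obtain ⟨j, hj⟩ : ∃ j : ℕ, (j : ℤ) = -z := ⟨(-z).toNat, Int.toNat_of_nonneg (by
    have : (0 : ℝ) ≤ -(z : ℝ) := (Nat.cast_nonneg J).trans hzJ
    exact_mod_cast this)⟩
  have hjR : (j : ℝ) = -(z : ℝ) := by exact_mod_cast hj
  refine ⟨k, j, by exact_mod_cast hjR ▸ hzJ, ?_⟩
  have hd : dist (k * α - j) u₀ < η := by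
    rw [Real.dist_eq, abs_sub_comm]
    rw [distInt, ← hz] at hnorm
    convert hnorm using 2
    rw [hjR]
    ring
  have h := hclose hd
  rw [hval, Real.dist_eq] at h
  convert h using 3
  rw [sub_mul, hα, mul_assoc, div_mul_cancel₀ _ hlB.ne', Real.exp_sub, ← Real.log_pow,
    ← Real.log_pow, Real.exp_log (by positivity), Real.exp_log (by positivity)]

lemma norm_digitSum_lt_one {D : Finset ℕ} {d d' : ℕ} (hd : d ∈ D) (hd' : d' ∈ D) {t : ℝ}
    (hne : addExp (t * d) ≠ addExp (t * d')) : ‖digitSum D t‖ < 1 := by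
  have hdd : d ≠ d' := fun h => hne (by rw [h])
  have hpair : ‖addExp (t * d) + addExp (t * d')‖ < 2 := by
    have h := parallelogram_law_with_norm ℝ (addExp (t * d)) (addExp (t * d'))
    have hpos : 0 < ‖addExp (t * d) - addExp (t * d')‖ := norm_pos_iff.2 (sub_ne_zero.2 hne)
    rw [norm_addExp, norm_addExp] at h
    nlinarith [norm_nonneg (addExp (t * d) + addExp (t * d'))]
  have hsub : {d, d'} ⊆ D := by
    intro x hx
    rcases Finset.mem_insert.1 hx with rfl | hx
    · exact hd
    · rwa [Finset.mem_singleton.1 hx]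
  have hcard : (D \ {d, d'}).card + 2 = D.card := by
    have := Finset.card_sdiff_add_card_eq_card hsub
    rwa [Finset.card_pair hdd] at this
  have hsum := Finset.sum_sdiff hsub (f := fun d : ℕ => addExp (t * d))
  rw [Finset.sum_pair hdd] at hsum
  have hrest : ‖∑ x ∈ D \ {d, d'}, addExp (t * x)‖ ≤ (D \ {d, d'}).card :=
    (norm_sum_le _ _).trans (by simp)
  have hpos : (0 : ℝ) < D.card := by exact_mod_cast (by omega : 0 < D.card)
  rw [digitSum, norm_mul, norm_inv, Complex.norm_natCast, inv_mul_lt_iff₀ hpos, mul_one, ← hsum]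
  have hcard' : ((D \ {d, d'}).card : ℝ) + 2 = D.card := by exact_mod_cast hcard
  exact (norm_add_le _ _).trans_lt (by linarith)

lemma addExp_eq_one_iff {t : ℝ} : addExp t = 1 ↔ ∃ k : ℤ, t = k := by
  refine ⟨fun h => ?_, fun ⟨k, hk⟩ => by rw [hk, addExp_int]⟩
  obtain ⟨k, hk⟩ := Complex.exp_eq_one_iff.1 h
  refine ⟨k, ?_⟩
  have h2 : ((t : ℝ) : ℂ) = ((k : ℝ) : ℂ) := by
    have hne : (2 * Real.pi * Complex.I : ℂ) ≠ 0 := Complex.two_pi_I_ne_zero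
    refine mul_right_cancel₀ hne ?_
    push_cast at hk ⊢
    linear_combination hk
  exact_mod_cast h2

/-- Digit sums at the fractions of prime denominator `p > B` are uniformly less than `1`. -/
lemma exists_norm_digitSum_le {B p : ℕ} {D : Finset ℕ} (hDB : ∀ d ∈ D, d < B) (hD : 2 ≤ D.card)
    (hp : p.Prime) (hpB : B < p) :
    ∃ ρ : ℝ, 0 ≤ ρ ∧ ρ < 1 ∧ ∀ r : ℕ, ¬ p ∣ r → ‖digitSum D (r / p)‖ ≤ ρ := by
  obtain ⟨d, hd, d', hd', hdd⟩ := Finset.one_lt_card.1 hD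
  have hp0 : (0 : ℝ) < p := by exact_mod_cast hp.pos
  have hlt : ∀ r : ℕ, ¬ p ∣ r → ‖digitSum D (r / p)‖ < 1 := fun r hr => by
    refine norm_digitSum_lt_one hd hd' fun h => ?_
    have h1 : addExp ((r : ℝ) / p * d - r / p * d') = 1 := by
      have h2 := addExp_add ((r : ℝ) / p * d - r / p * d') (r / p * d')
      rw [sub_add_cancel, h] at h2
      have h3 : addExp ((r : ℝ) / p * d') ≠ 0 := by
        rw [← norm_ne_zero_iff, norm_addExp]; exact one_ne_zero
      exact (mul_eq_right₀ h3).1 h2.symm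
    obtain ⟨k, hk⟩ := addExp_eq_one_iff.1 h1
    have hk' : (r : ℤ) * (d - d') = p * k := by
      have : (r : ℝ) * (d - d') = p * k := by rw [← hk]; field_simp
      exact_mod_cast this
    rcases (Nat.prime_iff_prime_int.1 hp).dvd_or_dvd (Dvd.intro k hk'.symm) with h | h
    · exact hr (Int.natCast_dvd_natCast.1 h)
    · have hd1 := hDB d hd
      have hd2 := hDB d' hd'
      have := Int.eq_zero_of_abs_lt_dvd h (by rw [abs_lt]; constructor <;> omega)
      omega
  obtain ⟨ρ, hρ0, hρ1, hρ⟩ : ∃ ρ : ℝ, 0 ≤ ρ ∧ ρ < 1 ∧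
      ∀ r ∈ (Finset.range p).filter (fun r => ¬ p ∣ r), ‖digitSum D (r / p)‖ ≤ ρ := by
    have : ∀ s : Finset ℕ, (∀ r ∈ s, ¬ p ∣ r) →
        ∃ ρ : ℝ, 0 ≤ ρ ∧ ρ < 1 ∧ ∀ r ∈ s, ‖digitSum D (r / p)‖ ≤ ρ := fun s => by
      induction s using Finset.induction_on with
      | empty => exact fun _ => ⟨0, le_rfl, one_pos, by simp⟩
      | insert a s _ ih =>
        intro hs
        obtain ⟨ρ, h0, h1, h⟩ := ih fun r hr => hs r (Finset.mem_insert_of_mem hr)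
        refine ⟨max ρ ‖digitSum D (a / p)‖, le_max_of_le_left h0,
          max_lt h1 (hlt a (hs a (Finset.mem_insert_self _ _))), fun r hr => ?_⟩
        rcases Finset.mem_insert.1 hr with rfl | hr
        · exact le_max_right _ _
        · exact (h r hr).trans (le_max_left _ _)
    exact this _ fun r hr => (Finset.mem_filter.1 hr).2
  refine ⟨ρ, hρ0, hρ1, fun r hr => ?_⟩
  have hmod : ((r : ℝ) / p) = ((r % p : ℕ) : ℝ) / p + ((r / p : ℕ) : ℤ) := by
    have : (r : ℝ) = p * ((r / p : ℕ) : ℝ) + ((r % p : ℕ) : ℝ) := by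
      exact_mod_cast (Nat.div_add_mod r p).symm
    rw [Int.cast_natCast]
    conv_lhs => rw [this]
    field_simp
    ring
  rw [hmod, digitSum_add_int]
  exact hρ _ (Finset.mem_filter.2 ⟨Finset.mem_range.2 (Nat.mod_lt _ hp.pos),
    fun h => hr ((Nat.dvd_mod_iff dvd_rfl).1 h)⟩)

namespace IsCantorMeasure

variable {B : ℕ} {D : Finset ℕ} {μ : Measure ℝ}

lemma exists_norm_fourierOf_le (hμ : IsCantorMeasure B D μ) (hB : 2 ≤ B) (hDB : ∀ d ∈ D, d < B)
    (hD : 2 ≤ D.card) {m : ℕ} (hm : 2 ≤ m) (hirr : Irrational (Real.log m / Real.log B))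
    (N H : ℕ) {ε : ℝ} (hε : 0 < ε) :
    ∃ k : ℕ, ∀ h : ℕ, 0 < h → h ≤ H →
      ‖fourierOf μ (h * ((m : ℝ) ^ k / (B : ℝ) ^ N))‖ ≤ ε := by
  have hB' : (0 : ℝ) < B := by positivity
  obtain ⟨p, hpge, hp⟩ := Nat.exists_infinite_primes (max H B + 1)
  have hpH : H < p := by omega
  have hpB : B < p := by omega
  have hp0 : (0 : ℝ) < p := by exact_mod_cast hp.pos
  obtain ⟨ρ, hρ0, hρ1, hρ⟩ := exists_norm_digitSum_le hDB hD hp hpB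
  obtain ⟨l, hl⟩ := exists_pow_lt_of_lt_one (half_pos hε) hρ1
  have hpi := Real.two_pi_pos
  have hδ : 0 < ε / 2 / (2 * Real.pi * ((H + 1) * (B : ℝ) ^ l)) := by positivity
  obtain ⟨k, j, hj, hkj⟩ := exists_pow_div_pow_near hm hB hirr (one_div_pos.2 hp0) hδ (N + l)
  refine ⟨k, fun h h0 hH => ?_⟩
  set θ := (m : ℝ) ^ k / (B : ℝ) ^ j with hθ
  have hHR : (h : ℝ) ≤ H + 1 := by exact_mod_cast (by omega : h ≤ H + 1)
  have hred : h * ((m : ℝ) ^ k / (B : ℝ) ^ N) / (B : ℝ) ^ (j - (N + l)) = h * (B : ℝ) ^ l * θ := by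
    obtain ⟨i, rfl⟩ := Nat.exists_eq_add_of_le hj
    rw [hθ, Nat.add_sub_cancel_left, pow_add, pow_add]
    field_simp
  refine (hμ.norm_fourierOf_le_div_pow _ (j - (N + l))).trans ?_
  rw [hred]
  have hfrac : ‖fourierOf μ (h * (B : ℝ) ^ l * (1 / p))‖ ≤ ε / 2 := by
    refine (hμ.norm_fourierOf_le_prod _ l).trans (le_trans ?_ hl.le)
    refine le_of_le_of_eq ?_ (Finset.prod_const ρ |>.trans (by rw [Finset.card_range]))
    refine Finset.prod_le_prod (fun _ _ => norm_nonneg _) fun i hi => ?_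
    have hil := Finset.mem_range.1 hi
    have e : h * (B : ℝ) ^ l * (1 / p) / (B : ℝ) ^ (i + 1)
        = ((h * B ^ (l - (i + 1)) : ℕ) : ℝ) / p := by
      obtain ⟨a, rfl⟩ := Nat.exists_eq_add_of_le (Nat.succ_le_of_lt hil)
      rw [Nat.succ_eq_add_one, Nat.add_sub_cancel_left]
      push_cast
      rw [pow_add]
      field_simp
    rw [e]
    refine hρ _ fun hdvd => ?_
    rcases hp.dvd_mul.1 hdvd with h' | h'
    · exact absurd (Nat.le_of_dvd h0 h') (by omega)
    · exact absurd (Nat.le_of_dvd (by omega) (hp.dvd_of_dvd_pow h')) (by omega)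
  have hdiff : ‖fourierOf μ (h * (B : ℝ) ^ l * θ) - fourierOf μ (h * (B : ℝ) ^ l * (1 / p))‖
      ≤ ε / 2 := by
    refine (hμ.norm_fourierOf_sub_le _ _).trans ?_
    rw [← mul_sub, abs_mul, abs_of_nonneg (by positivity)]
    calc 2 * Real.pi * (h * (B : ℝ) ^ l * |θ - 1 / p|)
        ≤ 2 * Real.pi * ((H + 1) * (B : ℝ) ^ l
          * (ε / 2 / (2 * Real.pi * ((H + 1) * (B : ℝ) ^ l)))) := by gcongr
      _ = ε / 2 := by field_simp
  calc _ = ‖fourierOf μ (h * (B : ℝ) ^ l * (1 / p)) + (fourierOf μ (h * (B : ℝ) ^ l * θ)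
        - fourierOf μ (h * (B : ℝ) ^ l * (1 / p)))‖ := by rw [add_sub_cancel]
    _ ≤ ε / 2 + ε / 2 := (norm_add_le _ _).trans (add_le_add hfrac hdiff)
    _ = ε := add_halves ε

lemma le_measureReal_hit (hμ : IsCantorMeasure B D μ) (hB : 2 ≤ B) (hDB : ∀ d ∈ D, d < B)
    (hD : 2 ≤ D.card) {m : ℕ} (hm : 2 ≤ m) (hirr : Irrational (Real.log m / Real.log B))
    {a : ℝ} (ha : 0 < a) (ha' : a ≤ 1 / 2) (x₀ : ℝ) (N w : ℕ) :
    a / 2 ≤ μ.real (cylMap B N w ⁻¹' {y | ∃ k : ℕ, distInt ((m : ℝ) ^ k * y + x₀) < a}) := by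
  have := hμ.isProb
  set T := ∑' n, tentCoeff a n with hT
  have hT0 : 0 ≤ T := tsum_nonneg fun n => tentCoeff_nonneg a n
  obtain ⟨H, hH⟩ := ((tendsto_order.1 (tendsto_sum_nat_add (tentCoeff a))).2 (a ^ 2 / 4)
    (by positivity)).exists
  have hε : 0 < a ^ 2 / (4 * (T + 1)) := by positivity
  obtain ⟨k, hk⟩ := hμ.exists_norm_fourierOf_le hB hDB hD hm hirr N H hε
  set t := (m : ℝ) ^ k / (B : ℝ) ^ N with ht
  have herr : ∑' n : ℕ, tentCoeff a n * ‖fourierOf μ (n * t)‖ ≤ a ^ 2 / 2 := by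
    have hle : ∀ n : ℕ, tentCoeff a n * ‖fourierOf μ (n * t)‖ ≤ tentCoeff a n := fun n =>
      mul_le_of_le_one_right (tentCoeff_nonneg a n) (norm_fourierOf_le_one μ _)
    have hs : Summable fun n : ℕ => tentCoeff a n * ‖fourierOf μ (n * t)‖ :=
      Summable.of_nonneg_of_le (fun n => mul_nonneg (tentCoeff_nonneg a n) (norm_nonneg _)) hle
        (summable_tentCoeff a)
    rw [← hs.sum_add_tsum_nat_add H]
    have h1 : ∑' n : ℕ, tentCoeff a (n + H) * ‖fourierOf μ ((n + H : ℕ) * t)‖ ≤ a ^ 2 / 4 := by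
      refine le_trans ?_ hH.le
      exact Summable.tsum_le_tsum (fun n => hle (n + H)) ((summable_nat_add_iff H).2 hs)
        ((summable_nat_add_iff H).2 (summable_tentCoeff a))
    have h2 : ∑ n ∈ Finset.range H, tentCoeff a n * ‖fourierOf μ (n * t)‖ ≤ a ^ 2 / 4 := by
      calc ∑ n ∈ Finset.range H, tentCoeff a n * ‖fourierOf μ (n * t)‖
          ≤ ∑ n ∈ Finset.range H, tentCoeff a n * (a ^ 2 / (4 * (T + 1))) := by
            refine Finset.sum_le_sum fun n hn => ?_
            rcases n.eq_zero_or_pos with rfl | hn0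
            · have h0 : tentCoeff a 0 = 0 := by
                simp [tentCoeff]
                positivity
              rw [h0, zero_mul, zero_mul]
            · exact mul_le_mul_of_nonneg_left (hk n hn0 (Finset.mem_range.1 hn).le)
                (tentCoeff_nonneg a n)
        _ ≤ T * (a ^ 2 / (4 * (T + 1))) := by
            rw [← Finset.sum_mul]
            gcongr
            exact (summable_tentCoeff a).sum_le_tsum _ fun n _ => tentCoeff_nonneg a n
        _ ≤ a ^ 2 / 4 := by
            rw [mul_div_assoc', div_le_div_iff₀ (by positivity) (by norm_num)]
            nlinarith [sq_nonneg a]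
    linarith
  set A : Set ℝ := {y | ∃ k : ℕ, distInt ((m : ℝ) ^ k * y + x₀) < a} with hA
  have hAo : IsOpen A := by
    have : A = ⋃ k : ℕ, {y | distInt ((m : ℝ) ^ k * y + x₀) < a} := by ext; simp [hA]
    rw [this]
    exact isOpen_iUnion fun k => isOpen_lt
      (continuous_distInt.comp (by fun_prop)) continuous_const
  have hmeas : MeasurableSet (cylMap B N w ⁻¹' A) := measurable_cylMap B N w hAo.measurableSet
  set s := (m : ℝ) ^ k * w / (B : ℝ) ^ N + x₀ with hs
  have hmain := (abs_le.1 ((abs_integral_tent_sub_le μ ha.le ha' t s).trans herr)).1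
  have hupper : ∫ x, tent a (t * x + s) ∂μ ≤ a * μ.real (cylMap B N w ⁻¹' A) := by
    have hind : ∫ x, (cylMap B N w ⁻¹' A).indicator (fun _ => a) x ∂μ
        = a * μ.real (cylMap B N w ⁻¹' A) := by
      rw [integral_indicator_const _ hmeas, smul_eq_mul, mul_comm]
    rw [← hind]
    refine integral_mono (integrable_tent μ ha.le t s)
      ((integrable_const _).indicator hmeas) fun x => ?_
    by_cases hx : x ∈ cylMap B N w ⁻¹' A
    · rw [indicator_of_mem hx]
      exact tent_le ha.le _
    · rw [indicator_of_notMem hx]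
      by_contra! hne
      refine hx ⟨k, ?_⟩
      have := distInt_lt_of_tent_ne_zero hne.ne'
      convert this using 2
      rw [ht, hs, cylMap]
      ring
  have : a * (a / 2) ≤ a * μ.real (cylMap B N w ⁻¹' A) := by nlinarith
  exact le_of_mul_le_mul_left this ha

/-- Almost every point has a dense orbit under multiplication by `m`. -/
lemma ae_exists_distInt_lt (hμ : IsCantorMeasure B D μ) (hB : 2 ≤ B) (hDB : ∀ d ∈ D, d < B)
    (hD : 2 ≤ D.card) {m : ℕ} (hm : 2 ≤ m) (hirr : Irrational (Real.log m / Real.log B)) :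
    ∀ᵐ x ∂μ, ∀ x₀ : ℝ, ∀ ε > 0, ∃ k : ℕ, distInt ((m : ℝ) ^ k * x - x₀) < ε := by
  have hall : ∀ (r : ℚ) (i : ℕ), ∀ᵐ x ∂μ,
      x ∈ {y : ℝ | ∃ k : ℕ, distInt ((m : ℝ) ^ k * y + (r : ℝ)) < 1 / ((i : ℝ) + 2)} := by
    intro r i
    have ha : (0 : ℝ) < 1 / ((i : ℝ) + 2) := by positivity
    have ha' : 1 / ((i : ℝ) + 2) ≤ 1 / 2 :=
      one_div_le_one_div_of_le two_pos (by linarith [(Nat.cast_nonneg i : (0 : ℝ) ≤ i)])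
    have hAo : IsOpen {y : ℝ | ∃ k : ℕ, distInt ((m : ℝ) ^ k * y + (r : ℝ)) < 1 / ((i : ℝ) + 2)} := by
      rw [ofPred_exists]
      exact isOpen_iUnion fun k => isOpen_lt
        (continuous_distInt.comp (by fun_prop)) continuous_const
    refine hμ.ae_mem_of_forall_le hB hDB hAo.measurableSet
      (c := ENNReal.ofReal (1 / ((i : ℝ) + 2) / 2)) (ENNReal.ofReal_pos.2 (by positivity)).ne'
      fun N w _ => ?_
    have := hμ.isProb
    rw [← ofReal_measureReal]
    exact ENNReal.ofReal_le_ofReal (hμ.le_measureReal_hit hB hDB hD hm hirr ha ha' r N w)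
  filter_upwards [ae_all_iff.2 fun r => ae_all_iff.2 (hall r)] with x hx x₀ ε hε
  obtain ⟨i, hi⟩ := exists_nat_gt (2 / ε)
  obtain ⟨r, hr1, hr2⟩ := exists_rat_btwn (by linarith : -x₀ - ε / 2 < -x₀)
  obtain ⟨k, hk⟩ := hx r i
  refine ⟨k, ?_⟩
  have h1 : 1 / ((i : ℝ) + 2) < ε / 2 := by
    rw [div_lt_iff₀ hε] at hi
    rw [div_lt_div_iff₀ (by positivity) two_pos]
    nlinarith
  refine (distInt_le _ (round ((m : ℝ) ^ k * x + r))).trans_lt ?_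
  rw [distInt] at hk
  have h2 : (m : ℝ) ^ k * x - x₀ - round ((m : ℝ) ^ k * x + r)
      = ((m : ℝ) ^ k * x + r - round ((m : ℝ) ^ k * x + r)) + (-x₀ - r) := by ring
  rw [h2]
  refine (abs_add_le _ _).trans_lt ?_
  rw [abs_of_pos (by linarith : 0 < -x₀ - (r : ℝ))]
  linarith

end IsCantorMeasure

/-- Discarding at most three digits for each point of a finite set `T` of the circle leaves a digit
set all of whose base-`B` cylinders of level one stay at distance `1 / B` from `T`. -/
lemma exists_digits_avoiding {B : ℕ} (hB : 0 < B) (T : Finset UnitAddCircle) :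
    ∃ D : Finset ℕ, (∀ d ∈ D, d < B) ∧ B ≤ D.card + 3 * T.card ∧
      ∀ d ∈ D, ∀ σ ∈ T, ∀ y ∈ Icc (0 : ℝ) 1,
        1 / (B : ℝ) ≤ ‖((((d : ℝ) + y) / B : ℝ) : UnitAddCircle) - σ‖ := by
  classical
  have hB' : (0 : ℝ) < B := by exact_mod_cast hB
  choose u hu using fun σ : UnitAddCircle => QuotientAddGroup.mk_surjective σ
  set bad : Finset ℕ := T.biUnion fun σ =>
    (Finset.Icc (⌊B * u σ⌋ - 1) (⌊B * u σ⌋ + 1)).image fun e : ℤ => (e % B).toNat with hbad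
  have hcard : bad.card ≤ 3 * T.card := by
    rw [mul_comm]
    refine Finset.card_biUnion_le_card_mul _ _ _ fun σ _ => Finset.card_image_le.trans ?_
    rw [Int.card_Icc]
    omega
  refine ⟨Finset.range B \ bad, fun d hd => ?_, ?_, fun d hd σ hσ y hy => ?_⟩
  · exact Finset.mem_range.1 (Finset.mem_sdiff.1 hd).1
  · have := Finset.le_card_sdiff bad (Finset.range B)
    rw [Finset.card_range] at this
    omega
  · obtain ⟨hd1, hd2⟩ := Finset.mem_sdiff.1 hd
    have hdB : d < B := Finset.mem_range.1 hd1
    by_contra! hlt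
    apply hd2
    have e1 : ((((d : ℝ) + y) / B : ℝ) : UnitAddCircle) - σ
        = ((((d : ℝ) + y) / B - u σ : ℝ) : UnitAddCircle) := by
      rw [AddCircle.coe_sub]
      congr 1
      exact (hu σ).symm
    rw [e1, ← distInt_eq_norm, distInt] at hlt
    set k := round (((d : ℝ) + y) / B - u σ) with hk
    have h2 : |(d : ℝ) + y - B * u σ - B * k| < 1 := by
      have : (d : ℝ) + y - B * u σ - B * k = B * (((d : ℝ) + y) / B - u σ - k) := by
        field_simp
      rw [this, abs_mul, abs_of_pos hB']
      calc (B : ℝ) * _ < B * (1 / B) := by gcongr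
        _ = 1 := by field_simp
    rw [abs_lt] at h2
    rw [hbad, Finset.mem_biUnion]
    refine ⟨σ, hσ, Finset.mem_image.2 ⟨(d : ℤ) - B * k, Finset.mem_Icc.2 ⟨?_, ?_⟩, ?_⟩⟩
    · have h3 : (⌊B * u σ⌋ : ℝ) - 2 < ((d : ℤ) - B * k : ℤ) := by
        push_cast
        have := Int.floor_le (B * u σ)
        linarith [hy.2]
      have h4 : ⌊B * u σ⌋ - 2 < (d : ℤ) - B * k := by exact_mod_cast h3
      omega
    · have h3 : (((d : ℤ) - B * k - 1 : ℤ) : ℝ) ≤ B * u σ := by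
        push_cast
        linarith [hy.1]
      have := Int.le_floor.2 h3
      omega
    · rw [Int.sub_mul_emod_self_left, Int.emod_eq_of_lt (by positivity) (by exact_mod_cast hdB)]
      simp

namespace IsCantorMeasure

variable {D : Finset ℕ} {μ : Measure ℝ}

/-- If the level-one cylinders stay away from `n ^ i • S` for all `i ≤ K`, then the orbit of
almost every point under multiplication by `n` stays away from `S`. -/
lemma ae_le_norm_nsmul_sub {n K : ℕ} (hn : 2 ≤ n) (hK : 0 < K)
    (hμ : IsCantorMeasure (n ^ K) D μ) (hDB : ∀ d ∈ D, d < n ^ K) {S : Set UnitAddCircle}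
    (hDS : ∀ d ∈ D, ∀ i ≤ K, ∀ s ∈ S, ∀ y ∈ Icc (0 : ℝ) 1,
      1 / ((n ^ K : ℕ) : ℝ) ≤ ‖((((d : ℝ) + y) / (n ^ K : ℕ) : ℝ) : UnitAddCircle) - n ^ i • s‖) :
    ∀ᵐ x : ℝ ∂μ, ∀ j : ℕ, ∀ s ∈ S,
      (1 / ((n ^ K : ℕ) : ℝ)) ^ 2 ≤ ‖n ^ j • (x : UnitAddCircle) - s‖ := by
  have hB : 2 ≤ n ^ K := hn.trans (Nat.le_self_pow hK.ne' n)
  filter_upwards [hμ.ae_mem_digitWords hB hDB] with x hx j s hs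
  have hB' : (0 : ℝ) < (n ^ K : ℕ) := by positivity
  set N := j / K + 1 with hN
  have hjN : j ≤ K * N ∧ K * N - j ≤ K := by
    have h1 := Nat.div_add_mod j K
    have h2 := Nat.mod_lt j hK
    rw [hN, mul_add, mul_one]
    omega
  obtain ⟨w, hw, y, hy, hxy⟩ := hx (N + 1)
  rw [digitWords, Finset.mem_image] at hw
  obtain ⟨⟨v, d⟩, hvd, rfl⟩ := hw
  obtain ⟨-, hd⟩ := Finset.mem_product.1 hvd
  have hd : d ∈ D := hd
  have e1 : n ^ (K * N) • (x : UnitAddCircle)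
      = ((((d : ℝ) + y) / (n ^ K : ℕ) : ℝ) : UnitAddCircle) := by
    rw [← AddCircle.coe_nsmul]
    have : n ^ (K * N) • x = ((d : ℝ) + y) / (n ^ K : ℕ) + v • (1 : ℝ) := by
      rw [hxy, cylMap, nsmul_eq_mul, nsmul_eq_mul, pow_mul]
      push_cast
      have : (n : ℝ) ^ K ≠ 0 := by positivity
      field_simp
      ring
    rw [this, AddCircle.coe_add, AddCircle.coe_nsmul, AddCircle.coe_period, smul_zero, add_zero]
  have h1 := hDS d hd (K * N - j) hjN.2 s hs y hy
  rw [← e1] at h1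
  have e2 : n ^ (K * N) • (x : UnitAddCircle) - n ^ (K * N - j) • s
      = n ^ (K * N - j) • (n ^ j • (x : UnitAddCircle) - s) := by
    rw [smul_sub, smul_smul, ← pow_add, Nat.sub_add_cancel hjN.1]
  rw [e2] at h1
  have h2 : ‖n ^ (K * N - j) • (n ^ j • (x : UnitAddCircle) - s)‖
      ≤ (n ^ K : ℕ) * ‖n ^ j • (x : UnitAddCircle) - s‖ := by
    refine norm_nsmul_le.trans ?_
    gcongr
    · omega
    · exact hjN.2
  have h3 := h1.trans h2
  rw [div_le_iff₀ hB'] at h3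
  rw [_root_.div_pow, one_pow, div_le_iff₀ (by positivity)]
  linarith

end IsCantorMeasure

lemma MultIndep.irrational_log_div_log {n m K : ℕ} (h : MultIndep n m) (hn : 2 ≤ n) (hm : 2 ≤ m)
    (hK : 0 < K) : Irrational (Real.log m / Real.log (n ^ K : ℕ)) := by
  rintro ⟨r, hr⟩
  have hlm : 0 < Real.log m := Real.log_pos (by exact_mod_cast hm)
  have hln : 0 < Real.log n := Real.log_pos (by exact_mod_cast hn)
  have hlB : Real.log (n ^ K : ℕ) = K * Real.log n := by push_cast; rw [Real.log_pow]
  have hK' : (0 : ℝ) < K := by exact_mod_cast hK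
  have hr0 : 0 < r := by
    have : (0 : ℝ) < r := by rw [hr, hlB]; positivity
    exact_mod_cast this
  obtain ⟨a, ha⟩ := Int.eq_ofNat_of_zero_le (Rat.num_pos.2 hr0).le
  have ha0 : 0 < a := by
    have := Rat.num_pos.2 hr0
    omega
  have hra : (r : ℝ) = a / r.den := by
    rw [Rat.cast_def, ha]
    simp
  have hden : (0 : ℝ) < r.den := by exact_mod_cast r.den_pos
  rw [hra, hlB, div_eq_div_iff hden.ne' (by positivity)] at hr
  refine h ⟨K * a, r.den, Nat.mul_pos hK ha0, r.den_pos, ?_⟩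
  have h1 : Real.log ((n : ℝ) ^ (K * a)) = Real.log ((m : ℝ) ^ r.den) := by
    rw [Real.log_pow, Real.log_pow]
    push_cast
    linarith
  have hn0 : (0 : ℝ) < n := by positivity
  have hm0 : (0 : ℝ) < m := by positivity
  have h2 := Real.log_injOn_pos (mem_Ioi.2 (pow_pos hn0 _)) (mem_Ioi.2 (pow_pos hm0 _)) h1
  exact_mod_cast h2

lemma closure_orbit_inter_eq_empty {n : ℕ} {S : Set Circ} {x : ℝ} {δ : ℝ} (hδ : 0 < δ)
    (h : ∀ j : ℕ, ∀ s ∈ S, δ ≤ ‖n ^ j • (x : Circ) - s‖) :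
    closure (Set.range fun k : ℕ => (fun y : Circ => (n : ℤ) • y)^[k] (x : Circ)) ∩ S = ∅ := by
  rw [eq_empty_iff_forall_notMem]
  rintro s ⟨hs, hsS⟩
  obtain ⟨_, ⟨k, rfl⟩, hk⟩ := Metric.mem_closure_iff.1 hs δ hδ
  have h1 := h k s hsS
  rw [dist_comm, dist_eq_norm] at hk
  simp only [smul_iterate] at hk
  rw [← Nat.cast_pow, natCast_zsmul] at hk
  linarith

lemma closure_orbit_eq_univ {m : ℕ} {x : ℝ}
    (h : ∀ x₀ : ℝ, ∀ ε > 0, ∃ k : ℕ, distInt ((m : ℝ) ^ k * x - x₀) < ε) :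
    closure (Set.range fun k : ℕ => (fun y : Circ => (m : ℤ) • y)^[k] (x : Circ)) = Set.univ := by
  rw [eq_univ_iff_forall]
  intro s
  obtain ⟨x₀, rfl⟩ := QuotientAddGroup.mk_surjective s
  refine Metric.mem_closure_iff.2 fun ε hε => ?_
  obtain ⟨k, hk⟩ := h x₀ ε hε
  refine ⟨_, ⟨k, rfl⟩, ?_⟩
  rw [dist_comm, dist_eq_norm]
  simp only [smul_iterate]
  rw [← Nat.cast_pow, natCast_zsmul]
  rw [distInt_eq_norm, AddCircle.coe_sub, ← Nat.cast_pow, ← nsmul_eq_mul, AddCircle.coe_nsmul] at hk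
  exact hk

lemma not_badlyApproximable1_of_forall_mem_approxSet {x : ℝ} (h : ∀ c > 0, x ∈ approxSet c) :
    ¬ BadlyApproximable1 x := by
  rintro ⟨c, hc, hx⟩
  obtain ⟨p, q, hq, hpq⟩ := h c hc
  exact absurd (hx p q hq) (not_le.2 hpq)

lemma eventually_affine_le_pow {b : ℝ} (hb : 1 < b) (a c : ℝ) :
    ∀ᶠ u : ℕ in atTop, a * u + c ≤ b ^ u := by
  have h1 := (tendsto_pow_const_div_const_pow_of_one_lt 1 hb).const_mul a
  have h2 := (tendsto_pow_const_div_const_pow_of_one_lt 0 hb).const_mul c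
  have h3 := h1.add h2
  simp only [mul_zero, add_zero, pow_one, pow_zero] at h3
  filter_upwards [h3.eventually (eventually_lt_nhds one_pos)] with u hu
  have hbu : 0 < b ^ u := by positivity
  rw [mul_div_assoc', mul_div_assoc', ← add_div, div_lt_one hbu] at hu
  linarith

lemma eventually_ofReal_le_dimH {n : ℕ} (hn : 2 ≤ n) {S : Set Circ} (hS : S.Finite) {E : Set ℝ}
    (hE : ∀ x : ℝ,
      closure (Set.range fun k : ℕ => (fun y : Circ => (n : ℤ) • y)^[k] (x : Circ)) ∩ S = ∅ →
      (∀ m : ℕ, 2 ≤ m → MultIndep n m →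
        closure (Set.range fun k : ℕ => (fun y : Circ => (m : ℤ) • y)^[k] (x : Circ)) = Set.univ) →
      ¬ BadlyApproximable1 x → x ∈ E) :
    ∀ᶠ u : ℕ in atTop, ENNReal.ofReal (1 - 1 / ((u : ℝ) + 1)) ≤ dimH E := by
  classical
  have hn1 : (1 : ℝ) < n := by exact_mod_cast hn
  filter_upwards [eventually_affine_le_pow hn1 (24 * Real.log n + 72 * hS.toFinset.card)
    (6 + 6 * hS.toFinset.card), eventually_ge_atTop 1] with u hu hu1
  set K := 12 * u with hKdef
  have hK : 0 < K := by omega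
  set B := n ^ K with hBdef
  have hB : 4 ≤ B := by
    calc 4 = 2 ^ 2 := by norm_num
      _ ≤ n ^ 2 := by gcongr
      _ ≤ n ^ K := Nat.pow_le_pow_right (by omega) (by omega)
  set T : Finset UnitAddCircle :=
    (Finset.range (K + 1) ×ˢ hS.toFinset).image fun p => n ^ p.1 • p.2 with hT
  have hTcard : T.card ≤ (K + 1) * hS.toFinset.card := by
    refine Finset.card_image_le.trans ?_
    rw [Finset.card_product, Finset.card_range]
  obtain ⟨D, hDB, hcard, hDT⟩ := exists_digits_avoiding (B := B) (by omega) T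
  set r := 3 * ((K + 1) * hS.toFinset.card) with hr
  have hlogB : Real.log B = 12 * u * Real.log n := by
    rw [hBdef, hKdef]; push_cast; rw [Real.log_pow]; push_cast; ring
  have hlogn : 0 < Real.log n := Real.log_pos hn1
  have hΛ : 2 * (3 + Real.log B + r) ≤ (n : ℝ) ^ u := by
    refine le_trans (le_of_eq ?_) hu
    rw [hlogB, hr, hKdef]; push_cast; ring
  have hrB : 2 * r ≤ B := by
    have h1 : (2 * r : ℝ) ≤ (n : ℝ) ^ u := by
      have : 0 ≤ Real.log B := by rw [hlogB]; positivity
      linarith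
    have h2 : 2 * r ≤ n ^ u := by exact_mod_cast h1
    exact h2.trans (Nat.pow_le_pow_right (by omega) (by omega))
  have hrD : B ≤ D.card + r := by omega
  have hD2 : B ≤ 2 * D.card := by omega
  have hD : 2 ≤ D.card := by omega
  have hB2 : 2 ≤ B := by omega
  obtain ⟨μ, hμ⟩ := exists_isCantorMeasure hB2 (Finset.card_pos.1 (by omega)) hDB
  have hmem : ∀ᵐ x ∂μ, x ∈ E := by
    have h1 := hμ.ae_le_norm_nsmul_sub (S := S) hn hK hDB fun d hd i hi s hs y hy =>
      hDT d hd _ (Finset.mem_image.2 ⟨(i, s), Finset.mem_product.2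
        ⟨Finset.mem_range.2 (by omega), hS.mem_toFinset.2 hs⟩, rfl⟩) y hy
    have h2 := hμ.ae_mem_approxSet hDB (digitSumBound_of_card hB2 hDB hrD hD2) hB2
      (β := (n : ℝ) ^ u) (one_lt_pow₀ hn1 (by omega))
      (by rw [hBdef, hKdef]; push_cast; ring) hΛ
    have h3 : ∀ᵐ x ∂μ, ∀ m : ℕ, 2 ≤ m → MultIndep n m →
        ∀ x₀ : ℝ, ∀ ε > 0, ∃ k : ℕ, distInt ((m : ℝ) ^ k * x - x₀) < ε := by
      refine ae_all_iff.2 fun m => ?_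
      by_cases hm : 2 ≤ m
      · by_cases hnm : MultIndep n m
        · filter_upwards [hμ.ae_exists_distInt_lt hB2 hDB hD hm
            (hnm.irrational_log_div_log hn hm hK)] with x hx _ _ using hx
        · exact ae_of_all _ fun x _ h => absurd h hnm
      · exact ae_of_all _ fun x h => absurd h hm
    filter_upwards [h1, h2, h3] with x hx1 hx2 hx3
    exact hE x (closure_orbit_inter_eq_empty (by positivity) hx1)
      (fun m hm hnm => closure_orbit_eq_univ (hx3 m hm hnm))
      (not_badlyApproximable1_of_forall_mem_approxSet hx2)
  refine le_trans (ENNReal.ofReal_le_ofReal ?_) (hμ.le_dimH hB2 hDB hD hmem)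
  have hu0 : (1 : ℝ) ≤ u := by exact_mod_cast hu1
  have hlog2 : Real.log 2 ≤ Real.log n := Real.log_le_log (by norm_num) (by exact_mod_cast hn)
  have hlogD : Real.log B - Real.log 2 ≤ Real.log D.card := by
    have hD0 : (D.card : ℝ) ≠ 0 := by positivity
    have h1 : (B : ℝ) ≤ 2 * D.card := by exact_mod_cast hD2
    have h2 := Real.log_le_log (by positivity) h1
    rw [Real.log_mul two_ne_zero hD0] at h2
    linarith
  have h4 : Real.log B / (u + 1) ≥ Real.log n := by
    rw [ge_iff_le, le_div_iff₀ (by positivity), hlogB]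
    nlinarith
  rw [le_div_iff₀ (by rw [hlogB]; positivity), sub_mul, one_mul, one_div, inv_mul_eq_div]
  linarith

theorem wellapproximable_dense_times_m_nondense_times_n (n : ℤ) (hn : 2 ≤ n)
    (S : Set Circ) (hS : S.Finite) :
    dimH ({s : ℝ |
        closure (Set.range fun k : ℕ => (fun x : Circ => n • x)^[k] (s : Circ)) ∩ S = ∅}
      ∩ (⋂ m ∈ {m : ℕ | 2 ≤ m ∧ MultIndep n m},
          {s : ℝ |
            closure (Set.range fun k : ℕ => (fun x : Circ => (m : ℤ) • x)^[k] (s : Circ))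
              = Set.univ})
      ∩ {s : ℝ | ¬ BadlyApproximable1 s}) = 1 := by
  lift n to ℕ using by omega
  refine le_antisymm ((dimH_mono (subset_univ _)).trans_eq Real.dimH_univ) ?_
  have hlim : Tendsto (fun u : ℕ => ENNReal.ofReal (1 - 1 / ((u : ℝ) + 1))) atTop (nhds 1) := by
    have := (tendsto_one_div_add_atTop_nhds_zero_nat (𝕜 := ℝ)).const_sub 1
    rw [sub_zero] at this
    simpa using ENNReal.tendsto_ofReal this
  refine le_of_tendsto hlim (eventually_ofReal_le_dimH (by exact_mod_cast hn) hS ?_)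
  intro x h1 h2 h3
  exact ⟨⟨h1, mem_iInter₂.2 fun m hm => h2 m hm.1 hm.2⟩, h3⟩
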